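/- arXiv:1307.0972 — 3 statements merged into one kernel-verified Lean document; each statement's English description precedes it below -/
import Mathlib

section
/- Let n = d_1 + … + d_k be a composition and W_P = S_{d_1} × … × S_{d_k} ≤ S_n the corresponding Young subgroup. Then the invariant subring R^{W_P} is a free module over Λ = R^{S_n} of rank equal to the index [S_n : W_P] = n!/(d_1!⋯d_k!). -/
set_option synthInstance.maxHeartbeats 1000000
set_option maxHeartbeats 1000000

open MvPolynomial

/-- If a monic polynomial over `A` of degree `n` splits in an `A`-algebra `B` generated by its
roots, then `B` is spanned over `A` by at most `n!` elements. -/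
theorem exists_finset_span_eq_top_card_le_factorial.{u, v} {B : Type v} [CommRing B] (n : ℕ) :
    ∀ (A : Type u) [CommRing A] [Algebra A B] (p : Polynomial A) (b : Fin n → B), p.Monic →
      p.map (algebraMap A B) = ∏ i, (Polynomial.X - Polynomial.C (b i)) →
      Algebra.adjoin A (Set.range b) = ⊤ →
      ∃ s : Finset B, s.card ≤ n.factorial ∧ Submodule.span A (s : Set B) = ⊤ := by
  classical
  induction n with
  | zero =>
    intro A _ _ p b _ _ hb
    refine ⟨{1}, by simp, ?_⟩
    rw [Set.range_eq_empty, Algebra.adjoin_empty] at hb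
    rw [Finset.coe_singleton, ← Submodule.one_eq_span, ← Algebra.toSubmodule_bot, hb,
      Algebra.top_toSubmodule]
  | succ n ih =>
    intro A _ _ p b hp hpb hb
    cases subsingleton_or_nontrivial B with
    | inl h => exact ⟨∅, by simp, Subsingleton.elim _ _⟩
    | inr h =>
    have : Nontrivial A := (algebraMap A B).domain_nontrivial
    have hdeg : p.natDegree = n + 1 := by
      rw [← hp.natDegree_map (algebraMap A B), hpb, Polynomial.natDegree_prod_of_monic _ _
        fun i _ => Polynomial.monic_X_sub_C (b i)]
      simp
    have hroot : Polynomial.aeval (b 0) p = 0 := by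
      rw [← Polynomial.eval_map_algebraMap, hpb, Polynomial.eval_prod]
      exact Finset.prod_eq_zero (Finset.mem_univ 0) (by simp)
    let φ : AdjoinRoot p →ₐ[A] B := AdjoinRoot.liftAlgHom p (Algebra.ofId A B) (b 0) hroot
    have hφ : φ (AdjoinRoot.root p) = b 0 := AdjoinRoot.liftAlgHom_root ..
    let : Algebra (AdjoinRoot p) B := φ.toRingHom.toAlgebra
    have : IsScalarTower A (AdjoinRoot p) B := .of_algebraMap_eq fun x => (φ.commutes x).symm
    have hX := Polynomial.monic_X_sub_C (AdjoinRoot.root p)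
    have hdvd : (Polynomial.X - Polynomial.C (AdjoinRoot.root p)) ∣ p.map (AdjoinRoot.of p) :=
      Polynomial.dvd_iff_isRoot.mpr (AdjoinRoot.isRoot_root p)
    obtain ⟨q, hq⟩ := hdvd
    have hqm : q.Monic := hX.of_mul_monic_left (hq ▸ hp.map _)
    have hqb : q.map (algebraMap (AdjoinRoot p) B) =
        ∏ i : Fin n, (Polynomial.X - Polynomial.C (b i.succ)) := by
      have h1 := congrArg (Polynomial.map (algebraMap (AdjoinRoot p) B)) hq
      rw [Polynomial.map_map, ← AdjoinRoot.algebraMap_eq, ← IsScalarTower.algebraMap_eq, hpb,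
        Polynomial.map_mul, Fin.prod_univ_succ] at h1
      simp only [Polynomial.map_sub, Polynomial.map_X, Polynomial.map_C] at h1
      have h0 : algebraMap (AdjoinRoot p) B (AdjoinRoot.root p) = b 0 := hφ
      rw [h0] at h1
      exact ((Polynomial.monic_X_sub_C (b 0)).isRegular.left h1).symm
    have hgen : Algebra.adjoin (AdjoinRoot p) (Set.range fun i : Fin n => b i.succ) = ⊤ := by
      rw [← top_le_iff]
      intro x _
      have hx : x ∈ Algebra.adjoin A (Set.range b) := hb ▸ Algebra.mem_top
      refine Algebra.adjoin_induction (fun y hy => ?_) (fun r => ?_) (fun _ _ _ _ => add_mem)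
        (fun _ _ _ _ => mul_mem) hx
      · obtain ⟨i, rfl⟩ := hy
        refine Fin.cases ?_ (fun j => ?_) i
        · rw [← hφ]
          exact Subalgebra.algebraMap_mem _ (AdjoinRoot.root p)
        · exact Algebra.subset_adjoin ⟨j, rfl⟩
      · rw [IsScalarTower.algebraMap_apply A (AdjoinRoot p) B]
        exact Subalgebra.algebraMap_mem _ _
    obtain ⟨t, ht, hts⟩ := ih (AdjoinRoot p) q (fun i => b i.succ) hqm hqb hgen
    let pb := AdjoinRoot.powerBasis' hp
    let s : Finset (AdjoinRoot p) := Finset.univ.image pb.basis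
    have hs : Submodule.span A (s : Set (AdjoinRoot p)) = ⊤ := by
      simpa [s] using pb.basis.span_eq
    have hsc : s.card ≤ n + 1 := by
      refine Finset.card_image_le.trans ?_
      simp [pb, hdeg]
    refine ⟨Finset.image₂ (· • ·) s t, ?_, ?_⟩
    · exact (Finset.card_image₂_le _ _ _).trans (Nat.mul_le_mul hsc ht)
    · rw [Finset.coe_image₂, Set.image2_smul, Submodule.span_smul_of_span_eq_top hs, hts,
        Submodule.restrictScalars_top]

section
variable {A B C : Type*} [CommRing A] [CommRing B] [CommRing C] [IsDomain C] [Algebra A B]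
  [Algebra A C] [Algebra B C] [IsScalarTower A B C] [FaithfulSMul A B] [FaithfulSMul B C]

attribute [local instance] FractionRing.liftAlgebra in
/-- Multiplicativity of the generic rank in a tower of domains. -/
theorem finrank_mul_finrank_of_isDomain :
    Module.finrank A B * Module.finrank B C = Module.finrank A C := by
  have := IsDomain.of_faithfulSMul B C
  have := IsDomain.of_faithfulSMul A B
  have := FaithfulSMul.trans A B C
  have : IsScalarTower (FractionRing A) (FractionRing B) (FractionRing C) := by
    refine .of_algebraMap_eq' (IsLocalization.ringHom_ext (nonZeroDivisors A) ?_)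
    ext x
    simp only [RingHom.comp_apply]
    rw [← IsScalarTower.algebraMap_apply A (FractionRing A) (FractionRing C),
      ← IsScalarTower.algebraMap_apply A (FractionRing A) (FractionRing B),
      IsScalarTower.algebraMap_apply A B (FractionRing B),
      ← IsScalarTower.algebraMap_apply B (FractionRing B) (FractionRing C),
      ← IsScalarTower.algebraMap_apply A B (FractionRing C)]
  rw [← IsFractionRing.finrank_eq A (FractionRing A) B (FractionRing B),
    ← IsFractionRing.finrank_eq B (FractionRing B) C (FractionRing C),
    ← IsFractionRing.finrank_eq A (FractionRing A) C (FractionRing C),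
    Module.finrank_mul_finrank]
end

attribute [local instance] FractionRing.liftAlgebra in
/-- A ring extension of domains with finite Galois group `G` has generic rank `|G|`. -/
theorem IsGaloisGroup.finrank_eq_card_of_isDomain (G A B : Type*) [Group G] [Finite G] [CommRing A]
    [CommRing B] [IsDomain B] [Algebra A B] [FaithfulSMul A B] [MulSemiringAction G B]
    [IsGaloisGroup G A B] : Module.finrank A B = Nat.card G := by
  have := IsDomain.of_faithfulSMul A B
  let := IsFractionRing.mulSemiringAction G B (FractionRing B)
  rw [← IsFractionRing.finrank_eq A (FractionRing A) B (FractionRing B),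
    IsGaloisGroup.card_eq_finrank G (FractionRing A) (FractionRing B)]

namespace MvPolynomial

section Symmetric

variable {n : ℕ} {K : Type*} [Field K]

/-- The polynomial ring is spanned over the symmetric polynomials by at most `n!` elements. -/
theorem exists_finset_span_symmetricSubalgebra_eq_top (n : ℕ) (K : Type*) [Field K] :
    ∃ s : Finset (MvPolynomial (Fin n) K), s.card ≤ n.factorial ∧
      Submodule.span (symmetricSubalgebra (Fin n) K) (s : Set (MvPolynomial (Fin n) K)) = ⊤ := by
  let P : Polynomial (MvPolynomial (Fin n) K) := ∏ i, (Polynomial.X - Polynomial.C (X i))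
  have hP : P.Monic := Polynomial.monic_prod_of_monic _ _ fun i _ => Polynomial.monic_X_sub_C _
  have hlift : P ∈ Polynomial.lifts
      (algebraMap (symmetricSubalgebra (Fin n) K) (MvPolynomial (Fin n) K)) := by
    rw [Polynomial.lifts_iff_coeff_lifts]
    intro k
    refine ⟨⟨P.coeff k, fun σ => ?_⟩, rfl⟩
    have : P.map (rename σ : MvPolynomial (Fin n) K →ₐ[K] _).toRingHom = P := by
      simp only [P, Polynomial.map_prod, Polynomial.map_sub, Polynomial.map_X, Polynomial.map_C]
      simpa using Equiv.prod_comp σ fun i =>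
        (Polynomial.X - Polynomial.C (X i) : Polynomial (MvPolynomial (Fin n) K))
    conv_rhs => rw [← this, Polynomial.coeff_map]
    rfl
  obtain ⟨p, hpP, -, hp⟩ := Polynomial.lifts_and_natDegree_eq_and_monic hlift hP
  refine exists_finset_span_eq_top_card_le_factorial n _ p X hp hpP ?_
  rw [← top_le_iff]
  intro f _
  induction f using MvPolynomial.induction_on with
  | C a =>
    exact Subalgebra.algebraMap_mem _ (⟨C a, IsSymmetric.C a⟩ : symmetricSubalgebra (Fin n) K)
  | add f g hf hg => exact add_mem (hf trivial) (hg trivial)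
  | mul_X f i hf => exact mul_mem (hf trivial) (Algebra.subset_adjoin ⟨i, rfl⟩)

theorem IsSymmetric.homogeneousComponent {σ R : Type*} [CommSemiring R] {f : MvPolynomial σ R}
    (hf : f.IsSymmetric) (d : ℕ) : (homogeneousComponent d f).IsSymmetric := fun e => by
  rw [rename_homogeneousComponent, hf e]

variable (n K) in
/-- The `K`-span of the products with a symmetric homogeneous factor of positive degree. -/
noncomputable def positiveSymmetricSpan : Submodule K (MvPolynomial (Fin n) K) :=
  Submodule.span K {v | ∃ (a : ℕ) (g r : MvPolynomial (Fin n) K),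
    0 < a ∧ g.IsHomogeneous a ∧ g.IsSymmetric ∧ v = g * r}

theorem symmetric_smul_mem_sup_positiveSymmetricSpan
    (S : Submodule K (MvPolynomial (Fin n) K)) (g : symmetricSubalgebra (Fin n) K)
    {f : MvPolynomial (Fin n) K} (hf : f ∈ S ⊔ positiveSymmetricSpan n K) :
    g • f ∈ S ⊔ positiveSymmetricSpan n K := by
  rw [Subalgebra.smul_def, smul_eq_mul, ← sum_homogeneousComponent (g : MvPolynomial (Fin n) K),
    Finset.sum_mul]
  refine Submodule.sum_mem _ fun a _ => ?_
  rcases Nat.eq_zero_or_pos a with rfl | ha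
  · rw [homogeneousComponent_zero, C_mul']
    exact Submodule.smul_mem _ _ hf
  · exact Submodule.mem_sup_right (Submodule.subset_span
      ⟨a, _, f, ha, homogeneousComponent_isHomogeneous a _, g.2.homogeneousComponent a, rfl⟩)

theorem span_sup_positiveSymmetricSpan_eq_top {s : Set (MvPolynomial (Fin n) K)}
    (hs : Submodule.span (symmetricSubalgebra (Fin n) K) s = ⊤) :
    Submodule.span K s ⊔ positiveSymmetricSpan n K = ⊤ := by
  rw [← top_le_iff]
  intro f _
  have hf : f ∈ Submodule.span (symmetricSubalgebra (Fin n) K) s := hs ▸ Submodule.mem_top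
  induction hf using Submodule.span_induction with
  | mem x hx => exact Submodule.mem_sup_left (Submodule.subset_span hx)
  | zero => exact zero_mem _
  | add x y _ _ hx hy => exact add_mem (hx trivial) (hy trivial)
  | smul g x _ hx => exact symmetric_smul_mem_sup_positiveSymmetricSpan _ g (hx trivial)

attribute [local instance] MvPolynomial.gradedAlgebra in
theorem IsHomogeneous.homogeneousComponent_mul {σ R : Type*} [CommSemiring R] {a : ℕ}
    {g : MvPolynomial σ R} (hg : g.IsHomogeneous a) (f : MvPolynomial σ R) (d : ℕ) :
    homogeneousComponent d (g * f) = if a ≤ d then g * homogeneousComponent (d - a) f else 0 := by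
  classical
  simp only [← decomposition.decompose'_apply]
  exact DirectSum.coe_decompose_mul_of_left_mem (homogeneousSubmodule σ R) d hg

/-- Graded Nakayama lemma for the polynomial ring over the symmetric polynomials. -/
theorem span_symmetricSubalgebra_eq_top_of_isHomogeneous {s : Set (MvPolynomial (Fin n) K)}
    (hhom : ∀ f ∈ s, ∃ d, f.IsHomogeneous d)
    (hs : Submodule.span K s ⊔ positiveSymmetricSpan n K = ⊤) :
    Submodule.span (symmetricSubalgebra (Fin n) K) s = ⊤ := by
  set M := Submodule.span (symmetricSubalgebra (Fin n) K) s
  have hsM : Submodule.span K s ≤ M.restrictScalars K :=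
    Submodule.span_le.mpr Submodule.subset_span
  have key (d : ℕ) : ∀ f : MvPolynomial (Fin n) K, homogeneousComponent d f ∈ M := by
    induction d using Nat.strong_induction_on with
    | _ d ih =>
    suffices h : (⊤ : Submodule K (MvPolynomial (Fin n) K)) ≤
        (M.restrictScalars K).comap (homogeneousComponent d) from fun f => h trivial
    rw [← hs, sup_le_iff, positiveSymmetricSpan, Submodule.span_le, Submodule.span_le]
    refine ⟨fun f hf => ?_, ?_⟩
    · obtain ⟨e, he⟩ := hhom f hf
      change homogeneousComponent d f ∈ M
      rw [homogeneousComponent_of_mem he]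
      split_ifs
      · exact Submodule.subset_span hf
      · exact zero_mem _
    · rintro _ ⟨a, g, r, ha, hg, hgs, rfl⟩
      change homogeneousComponent d (g * r) ∈ M
      rw [hg.homogeneousComponent_mul]
      split_ifs with had
      · exact M.smul_mem (⟨g, hgs⟩ : symmetricSubalgebra (Fin n) K) (ih (d - a) (by omega) r)
      · exact zero_mem _
  rw [← top_le_iff]
  intro f _
  rw [← sum_homogeneousComponent f]
  exact Submodule.sum_mem _ fun d _ => key d f

/-- A family of homogeneous polynomials spanning the polynomial ring over `K` contains at most
`n!` elements spanning it over the symmetric polynomials. -/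
theorem exists_fin_span_symmetricSubalgebra_eq_top {H : Set (MvPolynomial (Fin n) K)}
    (hhom : ∀ f ∈ H, ∃ d, f.IsHomogeneous d) (hH : Submodule.span K H = ⊤) :
    ∃ (m : ℕ) (g : Fin m → MvPolynomial (Fin n) K), m ≤ n.factorial ∧ (∀ i, g i ∈ H) ∧
      Submodule.span (symmetricSubalgebra (Fin n) K) (Set.range g) = ⊤ := by
  obtain ⟨s, hsc, hs⟩ := exists_finset_span_symmetricSubalgebra_eq_top n K
  set J := positiveSymmetricSpan n K
  have hmap {t : Set (MvPolynomial (Fin n) K)} :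
      Submodule.span K (J.mkQ '' t) = ⊤ ↔ Submodule.span K t ⊔ J = ⊤ := by
    rw [Submodule.span_image, Submodule.map_mkQ_eq_top, sup_comm]
  have hsJ := hmap.mpr (span_sup_positiveSymmetricSpan_eq_top hs)
  have : Module.Finite K (MvPolynomial (Fin n) K ⧸ J) :=
    ⟨Submodule.fg_def.mpr ⟨_, s.finite_toSet.image _, hsJ⟩⟩
  have hHJ : Submodule.span K (J.mkQ '' H) = ⊤ := hmap.mpr (by rw [hH, top_sup_eq])
  obtain ⟨f, hfH, hf, -⟩ := Submodule.exists_fun_fin_finrank_span_eq K (J.mkQ '' H)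
  choose g hgH hgf using hfH
  refine ⟨_, g, ?_, hgH, span_symmetricSubalgebra_eq_top_of_isHomogeneous ?_ ?_⟩
  · rw [hHJ, ← hsJ]
    classical
    rw [← Finset.coe_image]
    exact (finrank_span_finset_le_card _).trans (Finset.card_image_le.trans hsc)
  · rintro _ ⟨i, rfl⟩
    exact hhom _ (hgH i)
  · rw [← hmap, ← Set.range_comp, show J.mkQ ∘ g = f from _root_.funext hgf, hf, hHJ]

end Symmetric

section Action

/-- The action of permutations on polynomials by renaming the variables. -/
@[reducible]
noncomputable def permMulSemiringAction (σ R : Type*) [CommSemiring R] :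
    MulSemiringAction (Equiv.Perm σ) (MvPolynomial σ R) where
  smul e f := rename e f
  one_smul f := rename_id_apply f
  mul_smul e e' f := (rename_rename e' e f).symm
  smul_zero e := map_zero (rename e)
  smul_add e := map_add (rename e)
  smul_one e := map_one (rename e)
  smul_mul e := map_mul (rename e)

attribute [local instance] permMulSemiringAction

theorem perm_smul_def {σ R : Type*} [CommSemiring R] (e : Equiv.Perm σ) (f : MvPolynomial σ R) :
    e • f = rename e f := rfl

theorem isGaloisGroup_symmetricSubalgebra (σ R : Type*) [CommRing R] [Nontrivial R] :
    IsGaloisGroup (Equiv.Perm σ) (symmetricSubalgebra σ R) (MvPolynomial σ R) where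
  faithful := ⟨fun {e e'} h => Equiv.ext fun i => by
    simpa [perm_smul_def] using h (X i)⟩
  commutes := ⟨fun e g f => by
    rw [Subalgebra.smul_def, Subalgebra.smul_def, smul_eq_mul, smul_eq_mul, smul_mul',
      perm_smul_def e (g : MvPolynomial σ R), g.2 e]⟩
  isInvariant := ⟨fun f hf => ⟨⟨f, hf⟩, rfl⟩⟩

attribute [local instance] isGaloisGroup_symmetricSubalgebra

variable {n : ℕ} {K : Type*} [Field K]

theorem finrank_symmetricSubalgebra (n : ℕ) (K : Type*) [Field K] :
    Module.finrank (symmetricSubalgebra (Fin n) K) (MvPolynomial (Fin n) K) = n.factorial := by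
  rw [IsGaloisGroup.finrank_eq_card_of_isDomain (Equiv.Perm (Fin n)), Nat.card_perm, Nat.card_fin]

/-- The invariants of a group of permutations, as a subalgebra over the symmetric polynomials. -/
noncomputable abbrev invariantSubalgebra (K : Type*) [Field K] (W : Subgroup (Equiv.Perm (Fin n))) :
    Subalgebra (symmetricSubalgebra (Fin n) K) (MvPolynomial (Fin n) K) :=
  FixedPoints.subalgebra _ _ W

theorem mem_invariantSubalgebra {W : Subgroup (Equiv.Perm (Fin n))} {f : MvPolynomial (Fin n) K} :
    f ∈ invariantSubalgebra K W ↔ ∀ e ∈ W, rename e f = f :=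
  ⟨fun h e he => h ⟨e, he⟩, fun h e => h e e.2⟩

theorem finrank_invariantSubalgebra (W : Subgroup (Equiv.Perm (Fin n))) :
    Module.finrank (symmetricSubalgebra (Fin n) K) (invariantSubalgebra K W) = W.index := by
  have : FaithfulSMul (Equiv.Perm (Fin n)) (MvPolynomial (Fin n) K) :=
    IsGaloisGroup.faithful (symmetricSubalgebra (Fin n) K)
  have : IsGaloisGroup W (invariantSubalgebra K W) (MvPolynomial (Fin n) K) := inferInstance
  have : FaithfulSMul (symmetricSubalgebra (Fin n) K) (invariantSubalgebra K W) :=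
    (faithfulSMul_iff_algebraMap_injective _ _).mpr fun _ _ h =>
      Subtype.ext (congrArg (algebraMap (invariantSubalgebra K W) (MvPolynomial (Fin n) K)) h)
  have h := finrank_mul_finrank_of_isDomain (A := symmetricSubalgebra (Fin n) K)
    (B := invariantSubalgebra K W) (C := MvPolynomial (Fin n) K)
  rw [IsGaloisGroup.finrank_eq_card_of_isDomain W (invariantSubalgebra K W),
    IsGaloisGroup.finrank_eq_card_of_isDomain (Equiv.Perm (Fin n)) _ (MvPolynomial (Fin n) K),
    ← W.index_mul_card] at h
  exact Nat.eq_of_mul_eq_mul_right Nat.card_pos h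

variable [CharZero K]

/-- Averaging over a group of permutations is a graded projection onto the invariants. -/
theorem exists_projection_invariantSubalgebra (W : Subgroup (Equiv.Perm (Fin n))) :
    ∃ π : MvPolynomial (Fin n) K →ₗ[symmetricSubalgebra (Fin n) K] MvPolynomial (Fin n) K,
      (∀ f, π f ∈ invariantSubalgebra K W) ∧ (∀ f ∈ invariantSubalgebra K W, π f = f) ∧
      ∀ f d, f.IsHomogeneous d → (π f).IsHomogeneous d := by
  classical
  let a : symmetricSubalgebra (Fin n) K := algebraMap K _ (Fintype.card W : K)⁻¹
  have ha (f : MvPolynomial (Fin n) K) : a • f = (Fintype.card W : K)⁻¹ • f :=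
    algebraMap_smul _ _ f
  refine ⟨a • ∑ e : W, DistribSMul.toLinearMap (symmetricSubalgebra (Fin n) K)
    (MvPolynomial (Fin n) K) (e : Equiv.Perm (Fin n)), fun f => ?_, fun f hf => ?_, fun f d hf => ?_⟩
  · intro e
    simp only [LinearMap.smul_apply, LinearMap.sum_apply, DistribSMul.toLinearMap_apply]
    rw [Subgroup.smul_def, smul_comm, Finset.smul_sum]
    congr 1
    simp only [smul_smul]
    exact Equiv.sum_comp (Equiv.mulLeft e) fun e' : W => (e' : Equiv.Perm (Fin n)) • f
  · simp only [LinearMap.smul_apply, LinearMap.sum_apply, DistribSMul.toLinearMap_apply]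
    have he (e : W) : (e : Equiv.Perm (Fin n)) • f = f := hf e
    simp only [he, ha]
    simp [← Nat.cast_smul_eq_nsmul K, smul_smul]
  · simp only [LinearMap.smul_apply, LinearMap.sum_apply, DistribSMul.toLinearMap_apply]
    rw [ha]
    exact Submodule.smul_mem (homogeneousSubmodule (Fin n) K d) _
      (IsHomogeneous.sum _ _ _ fun e _ => hf.rename_isHomogeneous)

theorem free_invariantSubalgebra (W : Subgroup (Equiv.Perm (Fin n))) :
    Module.Free (symmetricSubalgebra (Fin n) K) (invariantSubalgebra K W) := by
  obtain ⟨π, hπ, hπ_id, hπ_hom⟩ := exists_projection_invariantSubalgebra (K := K) W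
  let H : Set (MvPolynomial (Fin n) K) :=
    {f | (∃ d, f.IsHomogeneous d) ∧ (f ∈ invariantSubalgebra K W ∨ π f = 0)}
  have hH : Submodule.span K H = ⊤ := by
    rw [← top_le_iff]
    intro f _
    rw [← sum_homogeneousComponent f]
    refine Submodule.sum_mem _ fun d _ => ?_
    set g := homogeneousComponent d f
    have hg : g.IsHomogeneous d := homogeneousComponent_isHomogeneous d f
    rw [← add_sub_cancel (π g) g]
    refine add_mem (Submodule.subset_span ⟨⟨d, hπ_hom g d hg⟩, .inl (hπ g)⟩)
      (Submodule.subset_span ⟨⟨d, hg.sub (hπ_hom g d hg)⟩, .inr ?_⟩)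
    rw [map_sub, hπ_id _ (hπ g), sub_self]
  obtain ⟨m, g, hm, hgH, hg⟩ := exists_fin_span_symmetricSubalgebra_eq_top (fun f hf => hf.1) hH
  have hli : LinearIndependent (symmetricSubalgebra (Fin n) K) g :=
    linearIndependent_of_top_le_span_of_card_le_finrank hg.ge
      (by rwa [Fintype.card_fin, finrank_symmetricSubalgebra])
  let b : {i // g i ∈ invariantSubalgebra K W} → invariantSubalgebra K W := fun i => ⟨g i, i.2⟩
  have hb : LinearIndependent (symmetricSubalgebra (Fin n) K) b :=
    .of_comp (invariantSubalgebra K W).val.toLinearMap (hli.comp _ Subtype.val_injective)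
  refine Module.Free.of_basis (Module.Basis.mk hb ?_)
  have hle : Submodule.span (symmetricSubalgebra (Fin n) K) (Set.range g) ≤
      ((Submodule.span (symmetricSubalgebra (Fin n) K) (Set.range b)).map
        (invariantSubalgebra K W).val.toLinearMap).comap π := by
    rw [Submodule.span_le]
    rintro _ ⟨i, rfl⟩
    rcases (hgH i).2 with hi | hi
    · exact ⟨b ⟨i, hi⟩, Submodule.subset_span ⟨_, rfl⟩, (hπ_id _ hi).symm⟩
    · rw [SetLike.mem_coe, Submodule.mem_comap, hi]
      exact zero_mem _
  rintro ⟨f, hf⟩ -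
  obtain ⟨f', hf', h⟩ := hle (hg.ge (Submodule.mem_top (x := f)))
  rw [hπ_id f hf] at h
  rwa [← show f' = ⟨f, hf⟩ from Subtype.ext h]

end Action

end MvPolynomial

/-- The index of the group of permutations preserving a coloring is a multinomial coefficient. -/
theorem Equiv.Perm.index_eq_of_forall_mem_iff {ι κ : Type*} [Fintype ι] [DecidableEq ι] [Fintype κ]
    [DecidableEq κ] (c : ι → κ) (W : Subgroup (Equiv.Perm ι))
    (hW : ∀ e : Equiv.Perm ι, e ∈ W ↔ ∀ x, c (e x) = c x) :
    W.index = (Fintype.card ι).factorial /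
      ∏ j, (Finset.univ.filter fun i => c i = j).card.factorial := by
  have hcard : Nat.card W = ∏ j, (Finset.univ.filter fun i => c i = j).card.factorial := by
    simp only [← Fintype.card_subtype]
    rw [← DomMulAct.stabilizer_card c, ← Nat.card_eq_fintype_card]
    exact Nat.card_congr (Equiv.subtypeEquivRight fun e => by rw [hW, funext_iff]; rfl)
  rw [← hcard, ← Fintype.card_perm, ← Nat.card_eq_fintype_card, ← W.index_mul_card,
    Nat.mul_div_cancel _ Nat.card_pos]

/-- for a composition `n = d_1 + … + d_k` with Young subgroup
`W_P = S_{d_1} × … × S_{d_k} ≤ S_n` (the stabilizer of the monotone block-coloring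
`c : Fin n → Fin k` whose fibers have sizes `d_j`), the invariant subring `R^{W_P}`
is a free module over `Λ = R^{S_n}` of rank `[S_n : W_P] = n!/(d_1!⋯d_k!)`. -/
theorem young_invariants_free_over_symmetric
    (n : ℕ) (hn : 1 ≤ n) (k : ℕ) (d : Fin k → ℕ) (hd : ∑ j, d j = n)
    -- the block coloring of {1,…,n} with consecutive blocks of sizes d_1,…,d_k
    (c : Fin n → Fin k) (hc : Monotone c)
    (hcard : ∀ j : Fin k, (Finset.univ.filter fun i => c i = j).card = d j)
    -- the Young subgroup W_P
    (WP : Subgroup (Equiv.Perm (Fin n)))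
    (hWP : ∀ σ : Equiv.Perm (Fin n), σ ∈ WP ↔ ∀ x, c (σ x) = c x)
    -- R^{W_P} as a Λ-submodule of R
    (SP : Submodule (symmetricSubalgebra (Fin n) ℂ) (MvPolynomial (Fin n) ℂ))
    (hSP : ∀ f : MvPolynomial (Fin n) ℂ,
      f ∈ SP ↔ ∀ σ ∈ WP, rename (⇑σ) f = f) :
    Module.Free (symmetricSubalgebra (Fin n) ℂ) SP ∧
    Module.finrank (symmetricSubalgebra (Fin n) ℂ) SP = WP.index ∧
    WP.index = Nat.factorial n / ∏ j, Nat.factorial (d j) := by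
  obtain rfl : SP = Subalgebra.toSubmodule (invariantSubalgebra ℂ WP) := by
    ext f
    rw [hSP, Subalgebra.mem_toSubmodule, mem_invariantSubalgebra]
  refine ⟨free_invariantSubalgebra WP, finrank_invariantSubalgebra WP, ?_⟩
  rw [Equiv.Perm.index_eq_of_forall_mem_iff c WP hWP, Fintype.card_fin]
  simp only [hcard]
end

section
/- The Λ-algebra End_Λ(R) of Λ-linear endomorphisms of R = ℂ[x_1,…,x_n] is generated as a ℂ-algebra by the multiplication operators m_{x_1},…,m_{x_n} (where m_{x_j}(f) = x_j·f) together with the Demazure operators δ_1,…,δ_{n−1}. -/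
set_option synthInstance.maxHeartbeats 4000000
set_option maxHeartbeats 4000000

open MvPolynomial

/-- The divided-difference sum `∑ j ∈ s, g j / ∏ i ∈ s \ {j}, (v i - v j)`. -/
noncomputable def dividedDiff {ι F : Type*} [DecidableEq ι] [Field F] (s : Finset ι)
    (v g : ι → F) : F :=
  ∑ j ∈ s, g j / ∏ i ∈ s.erase j, (v i - v j)

lemma dividedDiff_insert_insert {ι F : Type*} [DecidableEq ι] [Field F] {s : Finset ι} {a b : ι}
    (hab : a ≠ b) (ha : a ∉ s) (hb : b ∉ s) {v : ι → F} (hv : Function.Injective v) (g : ι → F) :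
    dividedDiff (insert a (insert b s)) v g * (v a - v b) =
      dividedDiff (insert b s) v g - dividedDiff (insert a s) v g := by
  have ha' : a ∉ insert b s := by simp [hab, ha]
  have hvab : v a - v b ≠ 0 := sub_ne_zero.2 (hv.ne hab)
  have hvba : v b - v a ≠ 0 := sub_ne_zero.2 (hv.ne hab.symm)
  have hprod : ∀ j ∉ s, ∏ i ∈ s, (v i - v j) ≠ 0 := fun j hj =>
    Finset.prod_ne_zero_iff.2 fun i hi => sub_ne_zero.2 (hv.ne (by rintro rfl; exact hj hi))
  have hs : ∀ j ∈ s, (g j / ∏ i ∈ (insert a (insert b s)).erase j, (v i - v j)) * (v a - v b) =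
      (g j / ∏ i ∈ (insert b s).erase j, (v i - v j)) -
        g j / ∏ i ∈ (insert a s).erase j, (v i - v j) := by
    intro j hj
    have hja : a ≠ j := by rintro rfl; exact ha hj
    have hjb : b ≠ j := by rintro rfl; exact hb hj
    have h1 : v a - v j ≠ 0 := sub_ne_zero.2 (hv.ne hja)
    have h2 : v b - v j ≠ 0 := sub_ne_zero.2 (hv.ne hjb)
    have h3 : ∏ i ∈ s.erase j, (v i - v j) ≠ 0 :=
      Finset.prod_ne_zero_iff.2 fun i hi =>
        sub_ne_zero.2 (hv.ne (Finset.ne_of_mem_erase hi))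
    rw [Finset.erase_insert_of_ne hja, Finset.erase_insert_of_ne hjb,
      Finset.erase_insert_of_ne hja,
      Finset.prod_insert (a := a) (s := insert b (s.erase j)) (by simp [hab, ha]),
      Finset.prod_insert (a := b) (by simp [hb]), Finset.prod_insert (a := a) (by simp [ha])]
    field_simp
    ring
  have hA := hprod a ha
  have hB := hprod b hb
  unfold dividedDiff
  rw [Finset.sum_insert ha', Finset.sum_insert hb, Finset.sum_insert hb, Finset.sum_insert ha,
    add_mul, add_mul, Finset.sum_mul, Finset.sum_congr rfl hs, Finset.sum_sub_distrib,
    Finset.erase_insert ha', Finset.erase_insert hb, Finset.erase_insert ha,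
    Finset.erase_insert_of_ne hab, Finset.erase_insert hb, Finset.prod_insert hb,
    Finset.prod_insert ha]
  field_simp
  ring

lemma dividedDiff_comp_equiv {ι F : Type*} [DecidableEq ι] [Field F] {s t : Finset ι}
    (σ : Equiv.Perm ι) (hst : s.map σ.toEmbedding = t) (v : ι → F) {g g' : ι → F}
    (hg : ∀ j ∈ s, g' j = g (σ j)) :
    dividedDiff s (v ∘ σ) g' = dividedDiff t v g := by
  subst hst
  unfold dividedDiff
  rw [Finset.sum_map]
  refine Finset.sum_congr rfl fun j hj => ?_
  rw [hg j hj]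
  have : (s.map σ.toEmbedding).erase (σ.toEmbedding j) = (s.erase j).map σ.toEmbedding := by
    rw [Finset.map_erase]
  rw [this, Finset.prod_map]
  simp

/-- `f` is invariant under the permutations of the variables of index less than `k`. -/
def IsSymmBelow {N : ℕ} (k : ℕ) (f : MvPolynomial (Fin N) ℂ) : Prop :=
  ∀ σ : Equiv.Perm (Fin N), (∀ j : Fin N, k ≤ j.val → σ j = j) → rename σ f = f

lemma IsSymmBelow.aeval_comp {N k : ℕ} {f : MvPolynomial (Fin N) ℂ} (hf : IsSymmBelow k f)
    {F : Type*} [Field F] [Algebra ℂ F] {v w : Fin N → F} (σ : Equiv.Perm (Fin N))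
    (hσ : ∀ j : Fin N, k ≤ j.val → σ j = j) (hvw : v ∘ σ = w) : aeval w f = aeval v f := by
  conv_rhs => rw [← hf σ hσ, aeval_rename, hvw]

lemma aeval_generic_injective {N : ℕ} :
    Function.Injective (aeval (R := ℂ) fun i : Fin N =>
      algebraMap (MvPolynomial (Fin N) ℂ) (FractionRing (MvPolynomial (Fin N) ℂ)) (X i)) := by
  have : (aeval (R := ℂ) fun i : Fin N =>
      algebraMap (MvPolynomial (Fin N) ℂ) (FractionRing (MvPolynomial (Fin N) ℂ)) (X i)) =
      IsScalarTower.toAlgHom ℂ (MvPolynomial (Fin N) ℂ) (FractionRing (MvPolynomial (Fin N) ℂ)) := by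
    ext i
    simp
  rw [this]
  exact IsFractionRing.injective _ _

/-- The operator subalgebra generated by multiplications by variables and the operators `D`. -/
noncomputable abbrev demazureAlgebra {n : ℕ}
    (D : Fin n → Module.End (symmetricSubalgebra (Fin (n + 1)) ℂ) (MvPolynomial (Fin (n + 1)) ℂ)) :
    Subalgebra ℂ
      (Module.End (symmetricSubalgebra (Fin (n + 1)) ℂ) (MvPolynomial (Fin (n + 1)) ℂ)) :=
  Algebra.adjoin ℂ
    ((Set.range fun j : Fin (n + 1) =>
        LinearMap.mulLeft (symmetricSubalgebra (Fin (n + 1)) ℂ) (X j)) ∪ Set.range D)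

lemma mulLeft_mem_demazureAlgebra {n : ℕ}
    (D : Fin n → Module.End (symmetricSubalgebra (Fin (n + 1)) ℂ) (MvPolynomial (Fin (n + 1)) ℂ))
    (f : MvPolynomial (Fin (n + 1)) ℂ) :
    LinearMap.mulLeft (symmetricSubalgebra (Fin (n + 1)) ℂ) f ∈ demazureAlgebra D := by
  induction f using MvPolynomial.induction_on with
  | C a =>
    convert (demazureAlgebra D).algebraMap_mem a using 1
    ext g
    simp [Module.algebraMap_end_apply, MvPolynomial.smul_eq_C_mul]
  | add p q hp hq =>
    convert add_mem hp hq using 1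
    ext g
    simp [add_mul]
  | mul_X p i hp =>
    convert mul_mem hp (Algebra.subset_adjoin (R := ℂ) (Or.inl ⟨i, rfl⟩)) using 1
    ext g
    simp

/-- The iterated Demazure operator `δ_m ⋯ δ_{k-1}` acts on polynomials that are symmetric below `k`
as a divided difference. -/
lemma exists_mem_demazureAlgebra_dividedDiff {n : ℕ}
    {D : Fin n → Module.End (symmetricSubalgebra (Fin (n + 1)) ℂ) (MvPolynomial (Fin (n + 1)) ℂ)}
    (hD : ∀ (i : Fin n) (f : MvPolynomial (Fin (n + 1)) ℂ),
      D i f * (X i.castSucc - X i.succ) = rename (⇑(Equiv.swap i.castSucc i.succ)) f - f)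
    (F : Type*) [Field F] [Algebra ℂ F] (k : Fin (n + 1)) (d m : ℕ) (hm : m + d = k) :
    ∃ E ∈ demazureAlgebra D, ∀ f, IsSymmBelow k f → ∀ v : Fin (n + 1) → F, Function.Injective v →
      aeval v (E f) = dividedDiff (Finset.univ.filter fun i : Fin (n + 1) => m ≤ i ∧ i ≤ k) v
        fun j => aeval (v ∘ Equiv.swap j k) f := by
  induction d generalizing m with
  | zero =>
    refine ⟨1, one_mem _, fun f _ v _ => ?_⟩
    have : (Finset.univ.filter fun i : Fin (n + 1) => m ≤ i ∧ i ≤ k) = {k} := by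
      ext i
      simp only [Finset.mem_filter, Finset.mem_univ, true_and, Finset.mem_singleton, Fin.ext_iff,
        Fin.le_def]
      omega
    rw [this]
    simp [dividedDiff]
  | succ d ih =>
    obtain ⟨E, hE, hEf⟩ := ih (m + 1) (by omega)
    have hmn : m < n := by omega
    let i : Fin n := ⟨m, hmn⟩
    refine ⟨-(D i * E), neg_mem (mul_mem (Algebra.subset_adjoin (Or.inr ⟨i, rfl⟩)) hE),
      fun f hf v hv => ?_⟩
    have hDi := hD i (E f)
    obtain ⟨a, ha⟩ : ∃ a, a = i.castSucc := ⟨_, rfl⟩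
    obtain ⟨b, hb⟩ : ∃ b, b = i.succ := ⟨_, rfl⟩
    rw [← ha, ← hb] at hDi
    have ham : a.val = m := congrArg Fin.val ha
    have hbm : b.val = m + 1 := congrArg Fin.val hb
    have hab : a ≠ b := by rw [Ne, Fin.ext_iff]; omega
    set P := Finset.univ.filter fun i : Fin (n + 1) => m + 2 ≤ i ∧ i ≤ k with hP
    have hbP : (Finset.univ.filter fun i : Fin (n + 1) => m + 1 ≤ i ∧ i ≤ k) = insert b P := by
      ext j
      simp only [hP, Finset.mem_filter, Finset.mem_univ, true_and, Finset.mem_insert, Fin.ext_iff,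
        Fin.le_def]
      omega
    have habP : (Finset.univ.filter fun i : Fin (n + 1) => m ≤ i ∧ i ≤ k) =
        insert a (insert b P) := by
      ext j
      simp only [hP, Finset.mem_filter, Finset.mem_univ, true_and, Finset.mem_insert, Fin.ext_iff,
        Fin.le_def]
      omega
    have haP : a ∉ P := by simp [hP, ham]
    have hbP' : b ∉ P := by simp [hP, hbm]
    have hvab : v a - v b ≠ 0 := sub_ne_zero.2 (hv.ne hab)
    rw [habP]
    refine mul_right_cancel₀ hvab ?_
    rw [dividedDiff_insert_insert hab haP hbP' hv]
    have key := congrArg (aeval v) hDi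
    rw [map_mul, map_sub, map_sub, aeval_X, aeval_X, aeval_rename, hEf f hf v hv,
      hEf f hf _ (hv.comp (Equiv.injective _)), hbP] at key
    rw [LinearMap.neg_apply, Module.End.mul_apply, map_neg, neg_mul, key, neg_sub]
    congr 1
    refine dividedDiff_comp_equiv _ ?_ v fun j hj => ?_
    · ext j
      simp only [Finset.mem_map_equiv, Finset.mem_insert, Equiv.symm_swap]
      by_cases hja : j = a
      · simp [hja]
      by_cases hjb : j = b
      · subst hjb
        simp [haP, hab, hab.symm, hbP']
      rw [Equiv.swap_apply_of_ne_of_ne hja hjb]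
      simp [hja, hjb]
    · have hs : b.val < k.val → ∀ l : Fin (n + 1), k.val ≤ l.val → Equiv.swap a b l = l := by
        intro hbk l hl
        refine Equiv.swap_apply_of_ne_of_ne ?_ ?_ <;> rw [Ne, Fin.ext_iff] <;> omega
      rcases lt_or_ge b.val k.val with hbk | hbk
      · refine hf.aeval_comp (Equiv.swap a b) (hs hbk) ?_
        have := Equiv.mul_swap_eq_swap_mul (Equiv.swap a b) j k
        rw [hs hbk k le_rfl] at this
        rw [Function.comp_assoc, Function.comp_assoc, ← Equiv.Perm.coe_mul, ← Equiv.Perm.coe_mul,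
          this]
      · have hbk' : b = k := Fin.ext (by omega)
        have hjb : j = b := by
          rcases Finset.mem_insert.1 hj with h | h
          · exact h
          · simp only [hP, Finset.mem_filter, Fin.le_def] at h
            omega
        rw [hjb, ← hbk', Equiv.swap_self, Equiv.swap_apply_right]
        rfl

/-- An operator sending polynomials symmetric below `k` to polynomials symmetric below `k + 1`,
from which those polynomials can be recovered. -/
lemma exists_mem_demazureAlgebra_isSymmBelow_succ {n : ℕ}
    {D : Fin n → Module.End (symmetricSubalgebra (Fin (n + 1)) ℂ) (MvPolynomial (Fin (n + 1)) ℂ)}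
    (hD : ∀ (i : Fin n) (f : MvPolynomial (Fin (n + 1)) ℂ),
      D i f * (X i.castSucc - X i.succ) = rename (⇑(Equiv.swap i.castSucc i.succ)) f - f)
    {F : Type*} [Field F] [Algebra ℂ F] {v : Fin (n + 1) → F}
    (hinj : Function.Injective (aeval (R := ℂ) v)) (k : Fin (n + 1)) :
    ∃ E ∈ demazureAlgebra D, ∃ (N : ℕ) (c : Fin N → MvPolynomial (Fin (n + 1)) ℂ),
      ∀ f, IsSymmBelow k f → (∀ l : Fin N, IsSymmBelow (k + 1) (E (X k ^ l.val * f))) ∧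
        f = ∑ l, c l * E (X k ^ l.val * f) := by
  have hv : Function.Injective v := by
    convert hinj.comp (X_injective (R := ℂ)) using 1
    ext i
    simp
  obtain ⟨E, hE, hEf⟩ := exists_mem_demazureAlgebra_dividedDiff hD F k k 0 (zero_add _)
  let p : Polynomial (MvPolynomial (Fin (n + 1)) ℂ) :=
    ∏ i ∈ Finset.univ.filter fun i : Fin (n + 1) => i < k,
      (Polynomial.C (X i) - Polynomial.X)
  have hXk : ∀ (l : ℕ) {f : MvPolynomial (Fin (n + 1)) ℂ}, IsSymmBelow k f →
      IsSymmBelow k (X k ^ l * f) := by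
    intro l f hf σ hσ
    rw [map_mul, map_pow, rename_X, hσ k le_rfl, hf σ hσ]
  refine ⟨E, hE, p.natDegree + 1, fun l => p.coeff l, fun f hf => ⟨fun l => ?_, ?_⟩⟩
  · have hg := hXk l hf
    generalize X k ^ l.val * f = g at hg
    intro σ hσ
    apply hinj
    rw [aeval_rename, hEf g hg v hv, hEf g hg _ (hv.comp σ.injective)]
    refine dividedDiff_comp_equiv σ ?_ v fun j hj => ?_
    · have hle : ∀ j, k < σ j ↔ k < j := fun j => by
        constructor
        · intro h
          have := σ.injective (hσ (σ j) h)
          rwa [this] at h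
        · intro h
          rwa [hσ j h]
      ext j
      have := hle (σ.symm j)
      rw [Equiv.apply_symm_apply] at this
      simp only [Finset.mem_map_equiv, Finset.mem_filter, Finset.mem_univ, true_and, Nat.zero_le,
        ← not_lt (a := k), this]
    · refine hg.aeval_comp (Equiv.swap (σ j) k * σ * Equiv.swap j k) ?_ ?_
      · intro l hl
        rcases eq_or_ne l k with rfl | hlk
        · simp
        · have hl' : k.val + 1 ≤ l.val := by
            have := Fin.val_ne_of_ne hlk
            omega
          have hlj : l ≠ j := by
            rintro rfl
            simp only [Finset.mem_filter, Fin.le_def] at hj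
            omega
          have hlσ : l ≠ σ j := fun h => hlj (σ.injective ((hσ l hl').trans h))
          simp [Equiv.swap_apply_of_ne_of_ne hlj hlk, hσ l hl',
            Equiv.swap_apply_of_ne_of_ne hlσ hlk]
      · ext l
        simp
  · apply hinj
    have hp : ∀ j, ∑ l : Fin (p.natDegree + 1), aeval v (p.coeff l) * v j ^ l.val =
        ∏ i ∈ Finset.univ.filter fun i : Fin (n + 1) => i < k, (v i - v j) := by
      intro j
      rw [Fin.sum_univ_eq_sum_range (fun l => aeval v (p.coeff l) * v j ^ l)]
      have := Polynomial.eval₂_eq_sum_range (p := p)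
        (aeval (R := ℂ) v : MvPolynomial (Fin (n + 1)) ℂ →+* F) (v j)
      simp only [RingHom.coe_coe] at this
      rw [← this, Polynomial.eval₂_finsetProd]
      simp [Polynomial.eval₂_sub]
    have hS : (Finset.univ.filter fun i : Fin (n + 1) => 0 ≤ i.val ∧ i ≤ k).erase k =
        Finset.univ.filter fun i : Fin (n + 1) => i < k := by
      ext i
      simp [lt_iff_le_and_ne, and_comm]
    rw [map_sum]
    simp_rw [map_mul]
    simp_rw [fun l : ℕ => hEf _ (hXk l hf) v hv]
    unfold dividedDiff
    simp_rw [Finset.mul_sum, map_mul, map_pow, aeval_X, Function.comp_apply,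
      Equiv.swap_apply_right]
    rw [Finset.sum_comm]
    have hterm : ∀ j, ∑ l : Fin (p.natDegree + 1), aeval v (p.coeff l) *
        (v j ^ l.val * aeval (v ∘ Equiv.swap j k) f /
          ∏ i ∈ (Finset.univ.filter fun i : Fin (n + 1) => 0 ≤ i.val ∧ i ≤ k).erase j,
            (v i - v j)) =
        (∏ i ∈ Finset.univ.filter fun i : Fin (n + 1) => i < k, (v i - v j)) *
          (aeval (v ∘ Equiv.swap j k) f /
          ∏ i ∈ (Finset.univ.filter fun i : Fin (n + 1) => 0 ≤ i.val ∧ i ≤ k).erase j,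
            (v i - v j)) := by
      intro j
      rw [← hp, Finset.sum_mul]
      refine Finset.sum_congr rfl fun l _ => ?_
      ring
    rw [Finset.sum_congr rfl fun j _ => hterm j, Finset.sum_eq_single k]
    · rw [hS, mul_div_cancel₀]
      · simp
      · refine Finset.prod_ne_zero_iff.2 fun i hi => sub_ne_zero.2 (hv.ne ?_)
        exact (Finset.mem_filter.1 hi).2.ne
    · intro j hj hjk
      rw [Finset.prod_eq_zero (i := j), zero_mul]
      · exact Finset.mem_filter.2 ⟨Finset.mem_univ _,
          lt_of_le_of_ne (Finset.mem_filter.1 hj).2.2 hjk⟩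
      · exact sub_self _
    · simp

/-- A reproducing family for `R` made of operators with values symmetric below `k`. -/
lemma exists_reproducing_family {n : ℕ}
    {D : Fin n → Module.End (symmetricSubalgebra (Fin (n + 1)) ℂ) (MvPolynomial (Fin (n + 1)) ℂ)}
    (hD : ∀ (i : Fin n) (f : MvPolynomial (Fin (n + 1)) ℂ),
      D i f * (X i.castSucc - X i.succ) = rename (⇑(Equiv.swap i.castSucc i.succ)) f - f)
    (k : ℕ) (hk : k ≤ n + 1) :
    ∃ (ι : Type) (_ : Fintype ι) (a : ι → MvPolynomial (Fin (n + 1)) ℂ)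
      (T : ι → Module.End (symmetricSubalgebra (Fin (n + 1)) ℂ) (MvPolynomial (Fin (n + 1)) ℂ)),
      (∀ i, T i ∈ demazureAlgebra D) ∧ (∀ i f, IsSymmBelow k (T i f)) ∧
        ∀ f, f = ∑ i, a i * T i f := by
  induction k with
  | zero =>
    refine ⟨Unit, inferInstance, fun _ => 1, fun _ => 1, fun _ => one_mem _, ?_, fun f => by simp⟩
    intro _ f σ hσ
    have : σ = 1 := Equiv.ext fun j => hσ j (Nat.zero_le _)
    simp [this]
  | succ k ih =>
    obtain ⟨ι, _, a, T, hT, hTs, hf⟩ := ih (by omega)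
    obtain ⟨E, hE, N, c, hc⟩ := exists_mem_demazureAlgebra_isSymmBelow_succ hD
      aeval_generic_injective ⟨k, hk⟩
    obtain ⟨M, hM, happ⟩ : ∃ M : Fin N → Module.End (symmetricSubalgebra (Fin (n + 1)) ℂ)
        (MvPolynomial (Fin (n + 1)) ℂ), (∀ l, M l ∈ demazureAlgebra D) ∧
          ∀ l f, M l f = E (X (⟨k, hk⟩ : Fin (n + 1)) ^ l.val * f) :=
      ⟨fun l => E * LinearMap.mulLeft _ (X (⟨k, hk⟩ : Fin (n + 1)) ^ l.val),
        fun l => mul_mem hE (mulLeft_mem_demazureAlgebra D _), fun l f => rfl⟩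
    refine ⟨ι × Fin N, inferInstance, fun q => a q.1 * c q.2, fun q => M q.2 * T q.1,
      fun q => mul_mem (hM _) (hT _), fun q f => ?_, fun f => ?_⟩
    · rw [Module.End.mul_apply, happ]
      exact (hc _ (hTs q.1 f)).1 q.2
    rw [Fintype.sum_prod_type]
    conv_lhs => rw [hf f]
    refine Finset.sum_congr rfl fun i _ => ?_
    conv_lhs => rw [(hc _ (hTs i f)).2, Finset.mul_sum]
    refine Finset.sum_congr rfl fun l _ => ?_
    rw [Module.End.mul_apply, happ, mul_assoc]

/-- `End_Λ(R)` is generated as a `ℂ`-algebra by the multiplication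
operators `m_{x_1},…,m_{x_{n+1}}` together with the Demazure operators
`δ_1,…,δ_n`.  (Here `R = ℂ[x_1,…,x_{n+1}]`, `Λ` the symmetric polynomials, and the
Demazure operator `δ_i` for `i : Fin n` is the `Λ`-linear map determined by
`δ_i(f)·(x_i − x_{i+1}) = s_i•f − f`.) -/
theorem end_generated_by_multiplications_and_demazures (n : ℕ)
    (D : Fin n → Module.End (symmetricSubalgebra (Fin (n + 1)) ℂ)
      (MvPolynomial (Fin (n + 1)) ℂ))
    (hD : ∀ (i : Fin n) (f : MvPolynomial (Fin (n + 1)) ℂ),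
      D i f * (X i.castSucc - X i.succ) =
        rename (⇑(Equiv.swap i.castSucc i.succ)) f - f) :
    Algebra.adjoin ℂ
      ((Set.range fun j : Fin (n + 1) =>
          LinearMap.mulLeft (symmetricSubalgebra (Fin (n + 1)) ℂ) (X j)) ∪
        Set.range D) = ⊤ := by
  rw [eq_top_iff]
  rintro φ -
  obtain ⟨ι, _, a, T, hT, hTs, hf⟩ := exists_reproducing_family hD (n + 1) le_rfl
  have hφ : φ = ∑ i, LinearMap.mulLeft (symmetricSubalgebra (Fin (n + 1)) ℂ) (φ (a i)) * T i := by
    ext1 f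
    conv_lhs => rw [hf f, map_sum]
    rw [LinearMap.sum_apply]
    refine Finset.sum_congr rfl fun i _ => ?_
    have hsymm : T i f ∈ symmetricSubalgebra (Fin (n + 1)) ℂ :=
      fun σ => hTs i f σ fun j hj => absurd j.isLt (by omega)
    have hsmul := φ.map_smul (⟨T i f, hsymm⟩ : symmetricSubalgebra (Fin (n + 1)) ℂ) (a i)
    rw [Subalgebra.smul_def, Subalgebra.smul_def, smul_eq_mul, smul_eq_mul] at hsmul
    rw [mul_comm, hsmul, mul_comm]
    rfl
  rw [hφ]
  exact sum_mem fun i _ => mul_mem (mulLeft_mem_demazureAlgebra D _) (hT i)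
end

section
/- The operators {δ_w : w ∈ S_n} form a basis of End_Λ(R) as a right R-module: every Λ-linear endomorphism h of R = ℂ[x_1,…,x_n] can be written uniquely as h = ∑_{w ∈ S_n} δ_w ∘ m_{f_w} for polynomials f_w ∈ R, where m_{f_w} is multiplication by f_w; i.e. End_Λ(R) = ⊕_{w ∈ S_n} δ_w ∘ m_R. -/
set_option synthInstance.maxHeartbeats 4000000
set_option maxHeartbeats 4000000

open MvPolynomial

namespace Demazure

/-! ### Words in the adjacent transpositions -/

section Words

variable {n : ℕ}

/-- The adjacent transposition exchanging `i` and `i + 1`. -/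
abbrev adjSwap (i : Fin n) : Equiv.Perm (Fin (n + 1)) := Equiv.swap i.castSucc i.succ

/-- The permutation spelled by a word in the adjacent transpositions. -/
def wordProd (l : List (Fin n)) : Equiv.Perm (Fin (n + 1)) := (l.map adjSwap).prod

@[simp] lemma wordProd_nil : wordProd ([] : List (Fin n)) = 1 := rfl

@[simp] lemma wordProd_cons (i : Fin n) (l : List (Fin n)) :
    wordProd (i :: l) = adjSwap i * wordProd l := by simp [wordProd]

@[simp] lemma wordProd_append (l l' : List (Fin n)) :
    wordProd (l ++ l') = wordProd l * wordProd l' := by simp [wordProd]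

/-- A word is reduced if no shorter word spells the same permutation. -/
def IsReducedWord (l : List (Fin n)) : Prop :=
  ∀ l' : List (Fin n), wordProd l' = wordProd l → l.length ≤ l'.length

lemma adjSwap_induction {motive : Equiv.Perm (Fin (n + 1)) → Prop} (one : motive 1)
    (mul : ∀ w i, motive w → motive (w * adjSwap i)) (w : Equiv.Perm (Fin (n + 1))) :
    motive w := by
  have hw : w ∈ Submonoid.closure
      (Set.range fun i : Fin n => Equiv.swap i.castSucc i.succ) := by
    rw [Equiv.Perm.mclosure_swap_castSucc_succ]; trivial
  induction hw using Submonoid.closure_induction_right with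
  | one => exact one
  | mul_right x hx y hy ih =>
    obtain ⟨i, rfl⟩ := hy
    exact mul x i ih

lemma exists_isReducedWord (w : Equiv.Perm (Fin (n + 1))) :
    ∃ l : List (Fin n), wordProd l = w ∧ IsReducedWord l := by
  have hex : ∃ l : List (Fin n), wordProd l = w := by
    induction w using adjSwap_induction with
    | one => exact ⟨[], rfl⟩
    | mul w i ih =>
      obtain ⟨l, rfl⟩ := ih
      exact ⟨l ++ [i], by simp⟩
  classical
  have hlen : ∃ k, ∃ l : List (Fin n), wordProd l = w ∧ l.length = k :=
    hex.imp' List.length fun l hl => ⟨l, hl, rfl⟩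
  obtain ⟨l, hl, hk⟩ := Nat.find_spec hlen
  exact ⟨l, hl, fun l' hl' => hk ▸ Nat.find_min' hlen ⟨l', hl'.trans hl, rfl⟩⟩

lemma sign_wordProd (l : List (Fin n)) :
    Equiv.Perm.sign (wordProd l) = (-1) ^ l.length := by
  induction l with
  | nil => simp
  | cons i l ih =>
    rw [wordProd_cons, map_mul, ih, Equiv.Perm.sign_swap (Fin.castSucc_lt_succ).ne, List.length_cons,
      pow_succ']

lemma length_ne_of_sign_eq_neg {l l' : List (Fin n)}
    (h : Equiv.Perm.sign (wordProd l') = -Equiv.Perm.sign (wordProd l)) :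
    l'.length ≠ l.length := by
  intro hlen
  rw [sign_wordProd, sign_wordProd, hlen] at h
  exact units_ne_neg_self _ h

lemma IsReducedWord.of_append {l l' : List (Fin n)} (h : IsReducedWord (l ++ l')) :
    IsReducedWord l := by
  intro k hk
  have := h (k ++ l') (by simp [hk])
  simpa using this

lemma IsReducedWord.append_singleton_or {l : List (Fin n)} (hl : IsReducedWord l) (i : Fin n) :
    IsReducedWord (l ++ [i]) ∨
      ∃ l', IsReducedWord (l' ++ [i]) ∧ wordProd (l' ++ [i]) = wordProd l := by
  obtain ⟨l', hl', hred⟩ := exists_isReducedWord (wordProd (l ++ [i]))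
  have hne : l'.length ≠ l.length := length_ne_of_sign_eq_neg (by
    rw [hl', wordProd_append, map_mul]
    simp [Equiv.Perm.sign_swap (Fin.castSucc_lt_succ).ne])
  have hprod : wordProd (l' ++ [i]) = wordProd l := by
    rw [wordProd_append, hl']
    simp [mul_assoc]
  by_cases hlt : l.length < l'.length
  · left
    intro k hk
    have := hred k (hk.trans hl'.symm)
    simp only [List.length_append, List.length_singleton]
    omega
  · right
    refine ⟨l', fun k hk => ?_, hprod⟩
    have := hl k (hk.trans hprod)
    simp only [List.length_append, List.length_singleton]
    omega

lemma IsReducedWord.cons_or {l : List (Fin n)} (hl : IsReducedWord l) (i : Fin n) :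
    IsReducedWord (i :: l) ∨
      ∃ l', IsReducedWord (i :: l') ∧ wordProd (i :: l') = wordProd l := by
  obtain ⟨l', hl', hred⟩ := exists_isReducedWord (wordProd (i :: l))
  have hne : l'.length ≠ l.length := length_ne_of_sign_eq_neg (by
    rw [hl', wordProd_cons, map_mul]
    simp [Equiv.Perm.sign_swap (Fin.castSucc_lt_succ).ne])
  have hprod : wordProd (i :: l') = wordProd l := by
    rw [wordProd_cons, hl']
    simp [← mul_assoc]
  by_cases hlt : l.length < l'.length
  · left
    intro k hk
    have := hred k (hk.trans hl'.symm)
    simp only [List.length_cons]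
    omega
  · right
    refine ⟨l', fun k hk => ?_, hprod⟩
    have := hl k (hk.trans hprod)
    simp only [List.length_cons]
    omega

/-- The pairs `a < b` in `Fin m`. -/
abbrev ltPairs (m : ℕ) : Finset (Fin m × Fin m) := Finset.univ.filter fun q => q.1 < q.2

/-- The number of inversions of a word's permutation is at most the length of the word. -/
lemma card_inversions_le (l : List (Fin n)) :
    ((ltPairs (n + 1)).filter fun q => wordProd l q.2 < wordProd l q.1).card ≤ l.length := by
  induction l with
  | nil =>
    simp only [wordProd_nil, Equiv.Perm.one_apply, List.length_nil, Nat.le_zero,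
      Finset.card_eq_zero]
    exact Finset.filter_eq_empty_iff.2 fun q hq => (Finset.mem_filter.1 hq).2.not_gt
  | cons i l ih =>
    refine (Finset.card_le_card (t := insert
      ((wordProd l).symm i.castSucc, (wordProd l).symm i.succ)
      ((ltPairs (n + 1)).filter fun q => wordProd l q.2 < wordProd l q.1)) ?_).trans
        ((Finset.card_insert_le _ _).trans (Nat.succ_le_succ ih))
    rintro ⟨a, b⟩ hq
    simp only [Finset.mem_filter, Finset.mem_univ, true_and, wordProd_cons,
      Equiv.Perm.mul_apply, Finset.mem_insert, Prod.mk.injEq, Equiv.eq_symm_apply] at hq ⊢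
    obtain ⟨hab, hlt⟩ := hq
    have hne : wordProd l a ≠ wordProd l b := fun h => hab.ne ((wordProd l).injective h)
    generalize wordProd l a = u at *
    generalize wordProd l b = v at *
    simp only [Equiv.swap_apply_def] at hlt
    split_ifs at hlt <;> simp only [Fin.ext_iff, Fin.lt_def, Fin.val_castSucc, Fin.val_succ,
      ne_eq] at * <;> omega

lemma exists_perm_card_ltPairs_le (n : ℕ) : ∃ w : Equiv.Perm (Fin (n + 1)),
    ∀ l : List (Fin n), wordProd l = w → (ltPairs (n + 1)).card ≤ l.length := by
  refine ⟨Fin.revPerm, fun l hl => le_trans (Finset.card_le_card ?_) (card_inversions_le l)⟩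
  intro q hq
  rw [Finset.mem_filter]
  refine ⟨hq, ?_⟩
  rw [hl]
  simpa using hq

lemma perm_eq_one_of_forall_le {m : ℕ} (w : Equiv.Perm (Fin m)) (h : ∀ b, b ≤ w b) : w = 1 := by
  have key := (Finset.sum_eq_sum_iff_of_le (s := Finset.univ) (f := fun b : Fin m => (b : ℕ))
    (g := fun b => (w b : ℕ)) fun b _ => h b).1
      (Equiv.sum_comp w fun b : Fin m => (b : ℕ)).symm
  ext b
  exact (key b (Finset.mem_univ b)).symm

end Words

/-! ### Expansions of operators over the fraction field -/

section Operators

variable {n : ℕ}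

/-- The polynomial ring in `n + 1` variables over `ℂ`. -/
abbrev Poly (n : ℕ) : Type := MvPolynomial (Fin (n + 1)) ℂ

/-- The endomorphisms of the polynomial ring that are linear over symmetric polynomials. -/
abbrev PolyEnd (n : ℕ) : Type :=
  Module.End (symmetricSubalgebra (Fin (n + 1)) ℂ) (Poly n)

/-- The field of rational functions in `n + 1` variables over `ℂ`. -/
abbrev RatFun (n : ℕ) : Type := FractionRing (Poly n)

/-- `P` acts on polynomials as `∑ w, c w • w`. -/
def IsExpansion (P : PolyEnd n) (c : Equiv.Perm (Fin (n + 1)) → RatFun n) : Prop :=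
  ∀ f : Poly n, algebraMap (Poly n) (RatFun n) (P f) =
    ∑ w, c w * algebraMap (Poly n) (RatFun n) (rename w f)

lemma eq_zero_of_forall_sum_eq_zero {c : Equiv.Perm (Fin (n + 1)) → RatFun n}
    (h : ∀ f : Poly n, ∑ w, c w * algebraMap (Poly n) (RatFun n) (rename w f) = 0) : c = 0 := by
  let F : Equiv.Perm (Fin (n + 1)) → (Poly n →* RatFun n) := fun w =>
    ((algebraMap (Poly n) (RatFun n)).comp (rename w : Poly n →ₐ[ℂ] Poly n).toRingHom).toMonoidHom
  have hF : Function.Injective F := by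
    intro w w' hww
    ext b
    have hb : algebraMap (Poly n) (RatFun n) (rename w (X b)) =
        algebraMap (Poly n) (RatFun n) (rename w' (X b)) := DFunLike.congr_fun hww (X b)
    have := IsFractionRing.injective (Poly n) (RatFun n) hb
    rw [rename_X, rename_X] at this
    exact congrArg Fin.val (X_injective this)
  have hli := (linearIndependent_monoidHom (Poly n) (RatFun n)).comp F hF
  rw [Fintype.linearIndependent_iff] at hli
  funext w
  refine hli c ?_ w
  funext f
  simpa [F, Finset.sum_apply] using h f

lemma X_sub_X_ne_zero {a b : Fin (n + 1)} (h : a ≠ b) : (X a - X b : Poly n) ≠ 0 :=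
  sub_ne_zero.2 fun hX => h (X_injective hX)

lemma algebraMap_X_sub_X_ne_zero {a b : Fin (n + 1)} (h : a ≠ b) :
    algebraMap (Poly n) (RatFun n) (X a - X b) ≠ 0 := by
  rw [Ne, IsFractionRing.to_map_eq_zero_iff]
  exact X_sub_X_ne_zero h

lemma algebraMap_root_ne_zero (w : Equiv.Perm (Fin (n + 1))) (i : Fin n) :
    algebraMap (Poly n) (RatFun n) (X (w i.castSucc) - X (w i.succ)) ≠ 0 :=
  algebraMap_X_sub_X_ne_zero (w.injective.ne (Fin.castSucc_lt_succ).ne)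

lemma rename_rename_perm (w w' : Equiv.Perm (Fin (n + 1))) (f : Poly n) :
    rename w (rename w' f) = rename (w * w') f := by
  rw [rename_rename]; rfl

/-- `D` is the family of Demazure operators. -/
def IsDemazure (D : Fin n → PolyEnd n) : Prop :=
  ∀ (i : Fin n) (f : Poly n), D i f * (X i.castSucc - X i.succ) = rename (adjSwap i) f - f

variable {D : Fin n → PolyEnd n}

lemma rename_adjSwap_root (i : Fin n) :
    rename (adjSwap i) (X i.castSucc - X i.succ : Poly n) = -(X i.castSucc - X i.succ) := by
  simp

lemma IsDemazure.rename_apply (hD : IsDemazure D) (i : Fin n) (f : Poly n) :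
    rename (adjSwap i) (D i f) = D i f := by
  apply mul_right_cancel₀ (X_sub_X_ne_zero (Fin.castSucc_lt_succ (i := i)).ne)
  have h := congrArg (rename (adjSwap i)) (hD i f)
  rw [map_mul, rename_adjSwap_root, map_sub, rename_rename_perm, Equiv.swap_mul_self] at h
  have h1 : rename (1 : Equiv.Perm (Fin (n + 1))) f = f := rename_id_apply f
  rw [h1] at h
  linear_combination -h - hD i f

lemma IsDemazure.mul_self (hD : IsDemazure D) (i : Fin n) : D i * D i = 0 := by
  refine LinearMap.ext fun f => ?_
  apply mul_right_cancel₀ (X_sub_X_ne_zero (Fin.castSucc_lt_succ (i := i)).ne)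
  rw [Module.End.mul_apply, hD, hD.rename_apply, sub_self, LinearMap.zero_apply, zero_mul]

/-- The twisted Leibniz rule, moving a multiplication operator past a Demazure operator. -/
lemma IsDemazure.mulLeft_mul (hD : IsDemazure D) (i : Fin n) (f : Poly n) :
    (LinearMap.mulLeft _ f * D i : PolyEnd n) =
      D i * LinearMap.mulLeft _ (rename (adjSwap i) f) -
        LinearMap.mulLeft _ (D i (rename (adjSwap i) f)) := by
  refine LinearMap.ext fun g => ?_
  apply mul_right_cancel₀ (X_sub_X_ne_zero (Fin.castSucc_lt_succ (i := i)).ne)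
  have h1 : rename (1 : Equiv.Perm (Fin (n + 1))) f = f := rename_id_apply f
  have h2 := hD i (rename (adjSwap i) f * g)
  have h3 := hD i (rename (adjSwap i) f)
  rw [rename_rename_perm, Equiv.swap_mul_self, h1] at h3
  rw [map_mul (rename (R := ℂ) (adjSwap i)), rename_rename_perm, Equiv.swap_mul_self, h1] at h2
  simp only [LinearMap.sub_apply, Module.End.mul_apply, LinearMap.mulLeft_apply]
  linear_combination f * hD i g - h2 + g * h3

lemma IsExpansion.mul_demazure (hD : IsDemazure D) {P : PolyEnd n}
    {c : Equiv.Perm (Fin (n + 1)) → RatFun n} (hP : IsExpansion P c) (i : Fin n) :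
    IsExpansion (P * D i) fun w => -(c (w * adjSwap i) + c w) /
      algebraMap (Poly n) (RatFun n) (X (w i.castSucc) - X (w i.succ)) := by
  intro f
  have hw : ∀ w : Equiv.Perm (Fin (n + 1)),
      c w * algebraMap (Poly n) (RatFun n) (rename w (D i f)) =
      c w / algebraMap (Poly n) (RatFun n) (X (w i.castSucc) - X (w i.succ)) *
        algebraMap (Poly n) (RatFun n) (rename (w * adjSwap i) f) -
      c w / algebraMap (Poly n) (RatFun n) (X (w i.castSucc) - X (w i.succ)) *
        algebraMap (Poly n) (RatFun n) (rename w f) := by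
    intro w
    have h := congrArg (fun g => algebraMap (Poly n) (RatFun n) (rename w g)) (hD i f)
    simp only [map_mul, map_sub (rename (R := ℂ) w), rename_X, rename_rename_perm] at h
    rw [map_sub _ (rename (w * adjSwap i) f)] at h
    have hne := algebraMap_root_ne_zero w i
    field_simp
    linear_combination c w * h
  rw [Module.End.mul_apply, hP, Finset.sum_congr rfl fun w _ => hw w, Finset.sum_sub_distrib,
    ← Equiv.sum_comp (Equiv.mulRight (adjSwap i)), ← Finset.sum_sub_distrib]
  refine Finset.sum_congr rfl fun w _ => ?_
  have hne := algebraMap_root_ne_zero w i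
  have hneg : algebraMap (Poly n) (RatFun n)
      (X ((w * adjSwap i) i.castSucc) - X ((w * adjSwap i) i.succ)) =
      -algebraMap (Poly n) (RatFun n) (X (w i.castSucc) - X (w i.succ)) := by
    simp
  have hcancel : w * adjSwap i * adjSwap i = w := by simp [mul_assoc]
  simp only [Equiv.coe_mulRight, hcancel]
  rw [hneg]
  field_simp
  ring

lemma isExpansion_one :
    IsExpansion (1 : PolyEnd n) fun w => if w = 1 then 1 else 0 := by
  intro f
  simp

/-- The expansion of a word in the Demazure operators is supported on the product of the word and
on permutations spelled by shorter words; for a reduced word, the leading coefficient is the inverse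
of a homogeneous polynomial whose degree is the length of the word. -/
lemma IsDemazure.exists_expansion_word (hD : IsDemazure D) (l : List (Fin n)) :
    ∃ c : Equiv.Perm (Fin (n + 1)) → RatFun n, IsExpansion (l.map D).prod c ∧
      (∀ w, c w ≠ 0 → w = wordProd l ∨ ∃ l', wordProd l' = w ∧ l'.length < l.length) ∧
      (IsReducedWord l → ∃ p : Poly n, p ≠ 0 ∧ p.IsHomogeneous l.length ∧
        c (wordProd l) * algebraMap (Poly n) (RatFun n) p = 1) := by
  induction l using List.reverseRecOn with
  | nil =>
    refine ⟨_, isExpansion_one, fun w hw => Or.inl ?_, fun _ => ⟨1, one_ne_zero, ?_, ?_⟩⟩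
    · by_contra h
      exact hw (if_neg h)
    · exact isHomogeneous_one _ _
    · simp
  | append_singleton l i ih =>
    obtain ⟨c, hc, hsupp, hlead⟩ := ih
    refine ⟨_, by simpa only [List.map_append, List.map_singleton, List.prod_append,
      List.prod_singleton] using hc.mul_demazure hD i, fun w hw => ?_, fun hred => ?_⟩
    · have hor : c (w * adjSwap i) ≠ 0 ∨ c w ≠ 0 := by
        by_contra! h
        simp [h.1, h.2] at hw
      simp only [wordProd_append, List.length_append, List.length_singleton]
      rcases hor with h | h
      · rcases hsupp _ h with h | ⟨l', hl', hlen⟩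
        · left
          simp [← h, mul_assoc]
        · right
          exact ⟨l' ++ [i], by simp [hl', mul_assoc], by simpa using hlen⟩
      · right
        rcases hsupp _ h with h | ⟨l', hl', hlen⟩
        · exact ⟨l, h.symm, by omega⟩
        · exact ⟨l', hl', by omega⟩
    · obtain ⟨p, hp0, hp, hcp⟩ := hlead hred.of_append
      set u := wordProd l with hu
      have hzero : c (u * adjSwap i) = 0 := by
        by_contra h
        rcases hsupp _ h with h | ⟨l', hl', hlen⟩
        · have h1 : adjSwap i = 1 := mul_left_cancel (h.trans (mul_one _).symm)
          exact (Fin.castSucc_lt_succ (i := i)).ne (Equiv.swap_eq_one_iff.1 h1)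
        · have := hred l' (by simp [hl', hu])
          simp only [List.length_append, List.length_singleton] at this
          omega
      have hne : u i.castSucc ≠ u i.succ := u.injective.ne (Fin.castSucc_lt_succ).ne
      refine ⟨p * (X (u i.castSucc) - X (u i.succ)), mul_ne_zero hp0 (X_sub_X_ne_zero hne), ?_, ?_⟩
      · simpa using hp.mul ((isHomogeneous_X ℂ (u i.castSucc)).sub (isHomogeneous_X ℂ (u i.succ)))
      · have hprod : wordProd (l ++ [i]) = u * adjSwap i := by simp [hu]
        have hcancel : u * adjSwap i * adjSwap i = u := by simp [mul_assoc]
        have hneg : algebraMap (Poly n) (RatFun n)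
            (X ((u * adjSwap i) i.castSucc) - X ((u * adjSwap i) i.succ)) =
            -algebraMap (Poly n) (RatFun n) (X (u i.castSucc) - X (u i.succ)) := by
          simp
        have hr := algebraMap_root_ne_zero u i
        rw [hprod, hcancel, hzero, hneg, map_mul]
        field_simp
        linear_combination hcp

end Operators

/-! ### Interpolation and the antisymmetrizer -/

section Interpolation

variable {n : ℕ}

/-- The separated form of the polynomial `∏ (x_a - y_b)` over `a < b`. -/
lemma exists_interpolation (n : ℕ) :
    ∃ (s : Finset (Fin (n + 1) →₀ ℕ)) (a b : (Fin (n + 1) →₀ ℕ) → Poly n),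
      ∀ w : Equiv.Perm (Fin (n + 1)), ∑ d ∈ s, a d * rename w (b d) =
        ∏ q ∈ ltPairs (n + 1), (X q.1 - X (w q.2)) := by
  let T : MvPolynomial (Fin (n + 1)) (Poly n) := ∏ q ∈ ltPairs (n + 1), (C (X q.1) - X q.2)
  refine ⟨T.support, fun d => coeff d T, fun d => ∏ i ∈ d.support, X i ^ d i, fun w => ?_⟩
  have h := eval₂_eq (RingHom.id (Poly n)) (fun b => (X (w b) : Poly n)) T
  simp only [RingHom.id_apply] at h
  simp only [map_prod, map_pow, rename_X]
  rw [← h, ← coe_eval₂Hom, map_prod]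
  simp

lemma prod_X_sub_X_perm_eq_zero {w : Equiv.Perm (Fin (n + 1))} (hw : w ≠ 1) :
    ∏ q ∈ ltPairs (n + 1), (X q.1 - X (w q.2) : Poly n) = 0 := by
  obtain ⟨b, hb⟩ : ∃ b, w b < b := by
    by_contra! h
    exact hw (perm_eq_one_of_forall_le w h)
  exact Finset.prod_eq_zero (i := (w b, b)) (by simpa using hb) (sub_self _)

/-- The antisymmetrization of a polynomial. -/
noncomputable def antisymmetrize (f : Poly n) : Poly n :=
  ∑ w : Equiv.Perm (Fin (n + 1)), ((Equiv.Perm.sign w : ℤ) : Poly n) * rename w f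

/-- The Vandermonde product `∏ (x_a - x_b)` over `a < b`. -/
noncomputable def vandermonde (n : ℕ) : Poly n := ∏ q ∈ ltPairs (n + 1), (X q.1 - X q.2)

lemma vandermonde_ne_zero : vandermonde n ≠ 0 :=
  Finset.prod_ne_zero_iff.2 fun _ hq => X_sub_X_ne_zero (Finset.mem_filter.1 hq).2.ne

lemma totalDegree_vandermonde : (vandermonde n).totalDegree = (ltPairs (n + 1)).card := by
  refine IsHomogeneous.totalDegree ?_ vandermonde_ne_zero
  simpa [vandermonde] using IsHomogeneous.prod (ltPairs (n + 1)) (fun q => (X q.1 - X q.2 : Poly n)) (fun _ => 1)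
    fun q _ => (isHomogeneous_X ℂ q.1).sub (isHomogeneous_X ℂ q.2)

lemma exists_sum_mul_antisymmetrize (n : ℕ) :
    ∃ (s : Finset (Fin (n + 1) →₀ ℕ)) (a b : (Fin (n + 1) →₀ ℕ) → Poly n),
      ∀ f, ∑ d ∈ s, a d * antisymmetrize (b d * f) = vandermonde n * f := by
  obtain ⟨s, a, b, h⟩ := exists_interpolation n
  refine ⟨s, a, b, fun f => ?_⟩
  calc ∑ d ∈ s, a d * antisymmetrize (b d * f)
      = ∑ w : Equiv.Perm (Fin (n + 1)), ((Equiv.Perm.sign w : ℤ) : Poly n) *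
          (∏ q ∈ ltPairs (n + 1), (X q.1 - X (w q.2))) * rename w f := by
        simp only [antisymmetrize, Finset.mul_sum]
        rw [Finset.sum_comm]
        refine Finset.sum_congr rfl fun w _ => ?_
        rw [← h w, Finset.mul_sum, Finset.sum_mul]
        refine Finset.sum_congr rfl fun d _ => ?_
        rw [map_mul]
        ring
    _ = vandermonde n * f := by
        rw [Finset.sum_eq_single 1 (fun w _ hw => by rw [prod_X_sub_X_perm_eq_zero hw]; simp)
          (by simp)]
        simp [vandermonde]

end Interpolation

/-! ### The operators attached to permutations -/

section Basis

variable {n : ℕ} {D : Fin n → PolyEnd n} {Dw : Equiv.Perm (Fin (n + 1)) → PolyEnd n}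

/-- `Dw w` is the product of `D` along any reduced word of `w`. -/
def IsWordFamily (D : Fin n → PolyEnd n) (Dw : Equiv.Perm (Fin (n + 1)) → PolyEnd n) : Prop :=
  ∀ l : List (Fin n), IsReducedWord l → Dw (wordProd l) = (l.map D).prod

lemma IsWordFamily.mul_demazure_eq_zero (hDw : IsWordFamily D Dw) (hD : IsDemazure D)
    {l : List (Fin n)} (hl : IsReducedWord l) {i : Fin n} (hi : ¬IsReducedWord (l ++ [i])) :
    Dw (wordProd l) * D i = 0 := by
  obtain ⟨l', h, hprod⟩ := (hl.append_singleton_or i).resolve_left hi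
  rw [← hprod, hDw _ h]
  simp [mul_assoc, hD.mul_self]

lemma IsWordFamily.mul_demazure (hDw : IsWordFamily D Dw) (hD : IsDemazure D)
    (w : Equiv.Perm (Fin (n + 1))) (i : Fin n) :
    Dw w * D i = 0 ∨ ∃ v, Dw w * D i = Dw v := by
  obtain ⟨l, rfl, hl⟩ := exists_isReducedWord w
  by_cases h : IsReducedWord (l ++ [i])
  · right
    exact ⟨_, by rw [hDw _ h, hDw _ hl]; simp⟩
  · left
    exact hDw.mul_demazure_eq_zero hD hl h

lemma IsWordFamily.demazure_mul (hDw : IsWordFamily D Dw) (hD : IsDemazure D)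
    {l : List (Fin n)} (hl : IsReducedWord l) {i : Fin n} (hi : ¬IsReducedWord (i :: l)) :
    D i * Dw (wordProd l) = 0 := by
  obtain ⟨l', h, hprod⟩ := (hl.cons_or i).resolve_left hi
  rw [← hprod, hDw _ h]
  simp [← mul_assoc, hD.mul_self]

lemma exists_longest_word (n : ℕ) : ∃ l : List (Fin n), IsReducedWord l ∧
    (ltPairs (n + 1)).card ≤ l.length ∧
    ∀ i, ¬IsReducedWord (i :: l) ∧ ¬IsReducedWord (l ++ [i]) := by
  choose L hL hred using exists_isReducedWord (n := n)
  obtain ⟨w₀, hmax⟩ := Finite.exists_max fun w => (L w).length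
  refine ⟨L w₀, hred w₀, ?_, fun i => ⟨fun h => ?_, fun h => ?_⟩⟩
  · obtain ⟨w, hw⟩ := exists_perm_card_ltPairs_le n
    exact (hw _ (hL w)).trans (hmax w)
  · have h1 := h _ (hL _)
    have h2 := hmax (wordProd (i :: L w₀))
    simp only [List.length_cons] at h1
    omega
  · have h1 := h _ (hL _)
    have h2 := hmax (wordProd (L w₀ ++ [i]))
    simp only [List.length_append, List.length_singleton] at h1
    omega

/-- The operator of the longest permutation is, up to sign, the antisymmetrizer divided by a
homogeneous polynomial of degree the length of that permutation. -/
lemma IsWordFamily.exists_apply_mul_eq_antisymmetrize (hDw : IsWordFamily D Dw)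
    (hD : IsDemazure D) {l : List (Fin n)} (hl : IsReducedWord l)
    (hmax : ∀ i, ¬IsReducedWord (l ++ [i])) :
    ∃ (p : Poly n) (ε : ℤˣ), p ≠ 0 ∧ p.IsHomogeneous l.length ∧
      ∀ f, Dw (wordProd l) f * p = ((ε : ℤ) : Poly n) * antisymmetrize f := by
  obtain ⟨c, hc, -, hlead⟩ := hD.exists_expansion_word l
  obtain ⟨p, hp0, hp, hcp⟩ := hlead hl
  rw [← hDw l hl] at hc
  have hswap : ∀ w i, c (w * adjSwap i) = -c w := by
    intro w i
    have hexp := hc.mul_demazure hD i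
    rw [hDw.mul_demazure_eq_zero hD hl (hmax i)] at hexp
    have h0 := congrFun (eq_zero_of_forall_sum_eq_zero fun f => by
      rw [← hexp f, LinearMap.zero_apply, map_zero]) w
    have hr := algebraMap_root_ne_zero w i
    rw [Pi.zero_apply, div_eq_zero_iff, or_iff_left hr] at h0
    linear_combination -h0
  have hsign : ∀ w, c w = ((Equiv.Perm.sign w : ℤ) : RatFun n) * c 1 := by
    intro w
    induction w using adjSwap_induction with
    | one => simp
    | mul w i ih =>
      rw [hswap, ih, map_mul, Equiv.Perm.sign_swap (Fin.castSucc_lt_succ).ne]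
      push_cast
      ring
  refine ⟨p, Equiv.Perm.sign (wordProd l), hp0, hp, fun f => ?_⟩
  have hsq : ((Equiv.Perm.sign (wordProd l) : ℤ) : RatFun n) *
      ((Equiv.Perm.sign (wordProd l) : ℤ) : RatFun n) = 1 := by
    rw [← Int.cast_mul, ← Units.val_mul, Int.units_mul_self, Units.val_one, Int.cast_one]
  have hc1 : c 1 * algebraMap (Poly n) (RatFun n) p =
      ((Equiv.Perm.sign (wordProd l) : ℤ) : RatFun n) := by
    rw [hsign] at hcp
    linear_combination ((Equiv.Perm.sign (wordProd l) : ℤ) : RatFun n) * hcp -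
      c 1 * algebraMap (Poly n) (RatFun n) p * hsq
  apply IsFractionRing.injective (Poly n) (RatFun n)
  rw [map_mul, hc f, map_mul, antisymmetrize, map_sum, Finset.mul_sum, Finset.sum_mul, map_intCast]
  refine Finset.sum_congr rfl fun w _ => ?_
  rw [hsign w, map_mul, map_intCast]
  linear_combination ((Equiv.Perm.sign w : ℤ) : RatFun n) *
    algebraMap (Poly n) (RatFun n) (rename w f) * hc1

/-- The operator of the longest permutation admits dual families. -/
lemma IsWordFamily.exists_dual (hDw : IsWordFamily D Dw)
    (hD : IsDemazure D) {l : List (Fin n)} (hl : IsReducedWord l)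
    (hlen : (ltPairs (n + 1)).card ≤ l.length) (hmax : ∀ i, ¬IsReducedWord (l ++ [i])) :
    ∃ (s : Finset (Fin (n + 1) →₀ ℕ)) (a b : (Fin (n + 1) →₀ ℕ) → Poly n),
      ∀ f, ∑ d ∈ s, Dw (wordProd l) (b d * f) * a d = f := by
  obtain ⟨p, ε, hp0, hp, hDp⟩ := hDw.exists_apply_mul_eq_antisymmetrize hD hl hmax
  obtain ⟨s, a, b, hab⟩ := exists_sum_mul_antisymmetrize n
  have hsum : ∀ f, (∑ d ∈ s, Dw (wordProd l) (b d * f) * a d) * p =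
      ((ε : ℤ) : Poly n) * (vandermonde n * f) := by
    intro f
    rw [← hab f, Finset.sum_mul, Finset.mul_sum]
    refine Finset.sum_congr rfl fun d _ => ?_
    linear_combination a d * hDp (b d * f)
  set κ : Poly n := ∑ d ∈ s, Dw (wordProd l) (b d * 1) * a d with hκ
  have hκp : κ * p = ((ε : ℤ) : Poly n) * vandermonde n := by
    rw [hκ, hsum 1, mul_one]
  have hε : ((ε : ℤ) : Poly n) = 1 ∨ ((ε : ℤ) : Poly n) = -1 := by
    rcases Int.units_eq_one_or ε with h | h <;> simp [h]
  have hdeg : (κ * p).totalDegree = (ltPairs (n + 1)).card := by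
    rw [hκp, ← totalDegree_vandermonde]
    rcases hε with h | h <;> simp [h]
  have hκ0 : κ ≠ 0 := by
    intro hκ0
    rw [hκ0, zero_mul, eq_comm] at hκp
    rcases hε with h | h <;> simp [h, vandermonde_ne_zero] at hκp
  rw [totalDegree_mul_of_isDomain hκ0 hp0, hp.totalDegree hp0] at hdeg
  have hC : κ = C (coeff 0 κ) := totalDegree_eq_zero_iff_eq_C.1 (by omega)
  have hk : coeff 0 κ ≠ 0 := by
    intro h
    rw [h, C_0] at hC
    exact hκ0 hC
  refine ⟨s, fun d => a d * C (coeff 0 κ)⁻¹, b, fun f => ?_⟩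
  have hinv : C (coeff 0 κ)⁻¹ * κ = 1 := by
    rw [hC, coeff_C, if_pos rfl, ← C_mul, inv_mul_cancel₀ hk, C_1]
  have hf : ∑ d ∈ s, Dw (wordProd l) (b d * f) * a d = κ * f := by
    apply mul_right_cancel₀ hp0
    rw [hsum f]
    linear_combination -f * hκp
  calc ∑ d ∈ s, Dw (wordProd l) (b d * f) * (a d * C (coeff 0 κ)⁻¹)
      = (∑ d ∈ s, Dw (wordProd l) (b d * f) * a d) * C (coeff 0 κ)⁻¹ := by
        simp only [Finset.sum_mul, mul_assoc]
    _ = f := by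
        rw [hf]
        linear_combination f * hinv

lemma IsDemazure.isSymmetric_of_forall_apply_eq_zero (hD : IsDemazure D) {f : Poly n}
    (hf : ∀ i, D i f = 0) : f.IsSymmetric := by
  intro w
  induction w using adjSwap_induction with
  | one => exact rename_id_apply f
  | mul w i ih =>
    have h := hD i f
    rw [hf i, zero_mul] at h
    rw [← rename_rename_perm, sub_eq_zero.1 h.symm, ih]

/-- The operators of the form `∑ w, Dw w ∘ m_{f w}`. -/
def rightSpan (Dw : Equiv.Perm (Fin (n + 1)) → PolyEnd n) : AddSubgroup (PolyEnd n) where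
  carrier := {P | ∃ f : Equiv.Perm (Fin (n + 1)) → Poly n,
    P = ∑ w, Dw w * LinearMap.mulLeft _ (f w)}
  zero_mem' := ⟨0, by simp⟩
  add_mem' := by
    rintro _ _ ⟨f, rfl⟩ ⟨g, rfl⟩
    refine ⟨f + g, ?_⟩
    rw [← Finset.sum_add_distrib]
    refine Finset.sum_congr rfl fun w _ => ?_
    rw [← mul_add]
    congr 1
    refine LinearMap.ext fun x => ?_
    simp [add_mul]
  neg_mem' := by
    rintro _ ⟨f, rfl⟩
    refine ⟨-f, ?_⟩
    rw [← Finset.sum_neg_distrib]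
    refine Finset.sum_congr rfl fun w _ => ?_
    refine LinearMap.ext fun x => ?_
    simp

lemma mul_mulLeft_mem_rightSpan (w : Equiv.Perm (Fin (n + 1))) (f : Poly n) :
    Dw w * LinearMap.mulLeft _ f ∈ rightSpan Dw := by
  classical
  refine ⟨Pi.single w f, ?_⟩
  rw [Finset.sum_eq_single w (fun v _ hv => by
    rw [Pi.single_eq_of_ne hv]; refine LinearMap.ext fun x => ?_; simp) (by simp),
    Pi.single_eq_same]

lemma rightSpan_mul_mem {Q : PolyEnd n}
    (h : ∀ w f, Dw w * LinearMap.mulLeft _ f * Q ∈ rightSpan Dw) {P : PolyEnd n}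
    (hP : P ∈ rightSpan Dw) : P * Q ∈ rightSpan Dw := by
  obtain ⟨f, rfl⟩ := hP
  rw [Finset.sum_mul]
  exact sum_mem fun w _ => h w (f w)

lemma rightSpan_mul_mulLeft_mem {P : PolyEnd n} (hP : P ∈ rightSpan Dw) (g : Poly n) :
    P * LinearMap.mulLeft _ g ∈ rightSpan Dw := by
  refine rightSpan_mul_mem (fun w f => ?_) hP
  have h : (LinearMap.mulLeft _ f * LinearMap.mulLeft _ g : PolyEnd n) =
      LinearMap.mulLeft _ (f * g) := LinearMap.ext fun x => by simp
  rw [mul_assoc, h]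
  exact mul_mulLeft_mem_rightSpan w _

lemma IsWordFamily.rightSpan_mul_demazure_mem (hDw : IsWordFamily D Dw) (hD : IsDemazure D)
    {P : PolyEnd n} (hP : P ∈ rightSpan Dw) (i : Fin n) : P * D i ∈ rightSpan Dw := by
  refine rightSpan_mul_mem (fun w f => ?_) hP
  rw [mul_assoc, hD.mulLeft_mul, mul_sub, ← mul_assoc]
  refine sub_mem ?_ (mul_mulLeft_mem_rightSpan w _)
  rcases hDw.mul_demazure hD w i with h | ⟨v, h⟩ <;> rw [h]
  · rw [zero_mul]
    exact zero_mem _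
  · exact mul_mulLeft_mem_rightSpan v _

lemma IsWordFamily.rightSpan_mul_word_mem (hDw : IsWordFamily D Dw) (hD : IsDemazure D)
    {P : PolyEnd n} (hP : P ∈ rightSpan Dw) (l : List (Fin n)) :
    P * (l.map D).prod ∈ rightSpan Dw := by
  induction l using List.reverseRecOn with
  | nil => simpa using hP
  | append_singleton l i ih =>
    simpa [mul_assoc] using hDw.rightSpan_mul_demazure_mem hD ih i

lemma IsWordFamily.mulLeft_mem_rightSpan (hDw : IsWordFamily D Dw) (g : Poly n) :
    LinearMap.mulLeft _ g ∈ rightSpan Dw := by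
  have h := hDw [] fun l' _ => Nat.zero_le _
  have hmem := mul_mulLeft_mem_rightSpan (Dw := Dw) 1 g
  rw [wordProd_nil] at h
  rwa [h, List.map_nil, List.prod_nil, one_mul] at hmem

theorem IsWordFamily.mem_rightSpan (hDw : IsWordFamily D Dw) (hD : IsDemazure D)
    (h : PolyEnd n) : h ∈ rightSpan Dw := by
  obtain ⟨l, hl, hlen, hmax⟩ := exists_longest_word n
  obtain ⟨s, a, b, hab⟩ := hDw.exists_dual hD hl hlen fun i => (hmax i).2
  have hsymm : ∀ f, Dw (wordProd l) f ∈ symmetricSubalgebra (Fin (n + 1)) ℂ := fun f =>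
    hD.isSymmetric_of_forall_apply_eq_zero fun i => by
      rw [← Module.End.mul_apply, hDw.demazure_mul hD hl (hmax i).1, LinearMap.zero_apply]
  have hsum : h = ∑ d ∈ s, LinearMap.mulLeft _ (h (a d)) * Dw (wordProd l) *
      LinearMap.mulLeft _ (b d) := by
    refine LinearMap.ext fun f => ?_
    conv_lhs => rw [← hab f, map_sum]
    rw [LinearMap.sum_apply]
    refine Finset.sum_congr rfl fun d _ => ?_
    have hlin := h.map_smul ⟨_, hsymm (b d * f)⟩ (a d)
    rw [Subalgebra.smul_def, Subalgebra.smul_def, smul_eq_mul, smul_eq_mul] at hlin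
    simp only [Module.End.mul_apply, LinearMap.mulLeft_apply]
    rw [hlin, mul_comm]
  rw [hsum]
  refine sum_mem fun d _ => rightSpan_mul_mulLeft_mem ?_ _
  rw [hDw l hl]
  exact hDw.rightSpan_mul_word_mem hD (hDw.mulLeft_mem_rightSpan _) l

theorem IsWordFamily.eq_zero_of_sum_eq_zero (hDw : IsWordFamily D Dw) (hD : IsDemazure D)
    {f : Equiv.Perm (Fin (n + 1)) → Poly n}
    (hf : ∑ w, Dw w * LinearMap.mulLeft _ (f w) = 0) : f = 0 := by
  choose L hL hred using exists_isReducedWord (n := n)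
  choose c hc hsupp hlead using hD.exists_expansion_word
  have hzero : ∀ u, ∑ v, c (L v) u * algebraMap (Poly n) (RatFun n) (rename u (f v)) = 0 := by
    refine congrFun (eq_zero_of_forall_sum_eq_zero fun g => ?_)
    have h := congrArg (algebraMap (Poly n) (RatFun n)) (LinearMap.congr_fun hf g)
    rw [LinearMap.sum_apply, map_sum, LinearMap.zero_apply, map_zero] at h
    rw [← h]
    simp only [Finset.sum_mul]
    rw [Finset.sum_comm]
    refine Finset.sum_congr rfl fun v _ => ?_
    have hv : Dw v = ((L v).map D).prod := by
      rw [← hDw _ (hred v), hL]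
    rw [Module.End.mul_apply, LinearMap.mulLeft_apply, hv, hc (L v)]
    refine Finset.sum_congr rfl fun u _ => ?_
    rw [map_mul (rename (R := ℂ) u), map_mul, mul_assoc]
  by_contra hne
  obtain ⟨w₁, hw₁⟩ := Function.ne_iff.1 hne
  classical
  obtain ⟨w, hw, hmax⟩ := Finset.exists_max_image (Finset.univ.filter fun w => f w ≠ 0)
    (fun w => (L w).length) ⟨w₁, by simpa using hw₁⟩
  have h := hzero w
  rw [Finset.sum_eq_single w ?_ (by simp)] at h
  · obtain ⟨p, -, -, hp⟩ := hlead (L w) (hred w)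
    rw [hL] at hp
    rcases mul_eq_zero.1 h with h | h
    · rw [h, zero_mul] at hp
      exact zero_ne_one hp
    · rw [IsFractionRing.to_map_eq_zero_iff] at h
      have := rename_injective w w.injective (h.trans (map_zero _).symm)
      exact (Finset.mem_filter.1 hw).2 this
  · intro v _ hv
    by_cases hfv : f v = 0
    · rw [hfv, map_zero, map_zero, mul_zero]
    · have hlen := hmax v (by simpa using hfv)
      have hcv : c (L v) w = 0 := by
        by_contra hcv
        rcases hsupp _ _ hcv with h | ⟨l', hl', hlt⟩
        · exact hv (h.trans (hL v)).symm
        · have := hred w l' (hl'.trans (hL w).symm)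
          omega
      rw [hcv, zero_mul]

end Basis

end Demazure

/-- the operators `δ_w`, `w ∈ S_{n+1}`, form a basis of `End_Λ(R)` as
a right `R`-module: every `Λ`-linear endomorphism `h` of `R = ℂ[x_1,…,x_{n+1}]` can
be written uniquely as `h = ∑_w δ_w ∘ m_{f_w}` with `f_w ∈ R`.  (Here `δ_i = D i`
is the Demazure operator determined by `δ_i(f)·(x_i − x_{i+1}) = s_i•f − f`, and
`δ_w = Dw w` is the composite of the `D i` along any reduced expression of `w`.) -/
theorem end_free_right_module_on_demazure_operators (n : ℕ)
    (D : Fin n → Module.End (symmetricSubalgebra (Fin (n + 1)) ℂ)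
      (MvPolynomial (Fin (n + 1)) ℂ))
    (hD : ∀ (i : Fin n) (f : MvPolynomial (Fin (n + 1)) ℂ),
      D i f * (X i.castSucc - X i.succ) =
        rename (⇑(Equiv.swap i.castSucc i.succ)) f - f)
    (Dw : Equiv.Perm (Fin (n + 1)) → Module.End (symmetricSubalgebra (Fin (n + 1)) ℂ)
      (MvPolynomial (Fin (n + 1)) ℂ))
    (hDw : ∀ (w : Equiv.Perm (Fin (n + 1))) (l : List (Fin n)),
      (l.map fun i => Equiv.swap i.castSucc i.succ).prod = w →
      (∀ l' : List (Fin n),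
        (l'.map fun i => Equiv.swap i.castSucc i.succ).prod = w →
          l.length ≤ l'.length) →
      Dw w = (l.map D).prod)
    (h : Module.End (symmetricSubalgebra (Fin (n + 1)) ℂ) (MvPolynomial (Fin (n + 1)) ℂ)) :
    ∃! f : Equiv.Perm (Fin (n + 1)) → MvPolynomial (Fin (n + 1)) ℂ,
      h = ∑ w : Equiv.Perm (Fin (n + 1)),
        Dw w ∘ₗ LinearMap.mulLeft (symmetricSubalgebra (Fin (n + 1)) ℂ) (f w) := by
  have hDw' : Demazure.IsWordFamily D Dw := fun l hl => hDw _ l rfl hl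
  obtain ⟨f, hf⟩ := hDw'.mem_rightSpan hD h
  refine ⟨f, hf, fun g hg => ?_⟩
  refine sub_eq_zero.1 (hDw'.eq_zero_of_sum_eq_zero hD ?_)
  rw [← sub_eq_zero.2 (hg.symm.trans hf), ← Finset.sum_sub_distrib]
  refine Finset.sum_congr rfl fun w _ => LinearMap.ext fun x => ?_
  simp [sub_mul]
end
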